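/- arXiv:1704.04975 — 4 statements merged into one kernel-verified Lean document; each statement's English description precedes it below -/
import Mathlib

section
/- Let z be an element of the center Z(R₀). Then there exists a unique k-linear map D_z : R₀ → R₀ such that for all w̃, u ∈ R with [ι(z), w̃] = ħ^N·u one has D_z(θ(w̃)) = θ(u); moreover D_z is a derivation of R₀, i.e. D_z(w·w') = D_z(w)·w' + w·D_z(w') for all w, w' ∈ R₀. (This is the 'special derivation of level N' ∂_z.) -/
/-- Taking the commutator with an element which is central modulo `ħ ^ N` descends to a well-defined
operation modulo `ħ`, after division by `ħ ^ N`. -/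
theorem map_eq_of_commutator_eq_pow_mul {R R₀ : Type*} [Ring R] [Ring R₀] {hbar : R}
    (hbar_central : ∀ r : R, hbar * r = r * hbar)
    (hbar_regular : ∀ r : R, hbar * r = 0 → r = 0)
    (θ : R →+* R₀) (θ_ker : ∀ r : R, θ r = 0 ↔ ∃ s : R, r = hbar * s) {N : ℕ} {c : R}
    (hc : ∀ r : R, ∃ u : R, c * r - r * c = hbar ^ N * u) {w w' u u' : R}
    (hw : θ w = θ w') (hu : c * w - w * c = hbar ^ N * u)
    (hu' : c * w' - w' * c = hbar ^ N * u') : θ u = θ u' := by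
  have pow_regular : ∀ (n : ℕ) (r : R), hbar ^ n * r = 0 → r = 0 := by
    intro n
    induction n with
    | zero => intro r hr; simpa using hr
    | succ n ih =>
      intro r hr
      rw [pow_succ, mul_assoc] at hr
      exact hbar_regular r (ih _ hr)
  obtain ⟨s, hs⟩ := (θ_ker (w - w')).1 (by rw [map_sub, hw, sub_self])
  obtain ⟨v, hv⟩ := hc s
  have key : u - u' = hbar * v := by
    refine sub_eq_zero.1 (pow_regular N _ ?_)
    calc hbar ^ N * (u - u' - hbar * v)
        = hbar ^ N * u - hbar ^ N * u' - hbar * (hbar ^ N * v) := by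
          rw [mul_sub, mul_sub, ← mul_assoc, ← mul_assoc, ← pow_succ, ← pow_succ']
      _ = c * (w - w') - (w - w') * c - hbar * (c * s - s * c) := by
          rw [← hu, ← hu', ← hv]; noncomm_ring
      _ = (c * hbar - hbar * c) * s := by rw [hs]; noncomm_ring
      _ = 0 := by rw [hbar_central c, sub_self, zero_mul]
  rw [← sub_eq_zero, ← map_sub]
  exact (θ_ker _).2 ⟨v, key⟩

/-- **Special derivation of level N** (Walton–Wang–Yakimov, Poisson geometry of PI
3-dimensional Sklyanin algebras).

Setting: `k` is an algebraically closed field of characteristic zero, `R` an associative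
unital `k`-algebra, `ħ = hbar` a central regular element of `R`, `R₀ = R/ħR` realized as the
codomain of the canonical (surjective) projection `θ` whose kernel is `ħR`.  `N` is a positive
integer and `ι : Z(R₀) → R` is a `k`-linear section of `θ` such that `[ι(z), r] ∈ ħ^N·R` for
all `z ∈ Z(R₀)`, `r ∈ R`.

Statement: for each `z ∈ Z(R₀)` there is a unique `k`-linear map `D : R₀ → R₀` such that
whenever `[ι(z), w̃] = ħ^N · u` one has `D (θ w̃) = θ u`; moreover `D` is a derivation of
`R₀`. -/
theorem special_derivation_of_level_N_exists_unique
    (k : Type*) [Field k] [IsAlgClosed k] [CharZero k]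
    (R R₀ : Type*) [Ring R] [Algebra k R] [Ring R₀] [Algebra k R₀]
    (hbar : R)
    (hbar_central : ∀ r : R, hbar * r = r * hbar)
    (hbar_regular : ∀ r : R, hbar * r = 0 → r = 0)
    (θ : R →ₐ[k] R₀)
    (θ_surj : Function.Surjective θ)
    (θ_ker : ∀ r : R, θ r = 0 ↔ ∃ s : R, r = hbar * s)
    (N : ℕ) (hN : 0 < N)
    (ι : ↥(Subalgebra.center k R₀) →ₗ[k] R)
    (ι_section : ∀ z : ↥(Subalgebra.center k R₀), θ (ι z) = (z : R₀))
    (ι_comm : ∀ (z : ↥(Subalgebra.center k R₀)) (r : R),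
      ∃ u : R, ι z * r - r * ι z = hbar ^ N * u)
    (z : ↥(Subalgebra.center k R₀)) :
    ∃! D : R₀ →ₗ[k] R₀,
      (∀ w u : R, ι z * w - w * ι z = hbar ^ N * u → D (θ w) = θ u) ∧
      (∀ w w' : R₀, D (w * w') = D w * w' + w * D w') := by
  have pow_central : ∀ r : R, hbar ^ N * r = r * hbar ^ N := fun r =>
    ((show Commute hbar r from hbar_central r).pow_left N).eq
  choose U hU using ι_comm z
  choose g hg using θ_surj
  have spec : ∀ w u : R, ι z * w - w * ι z = hbar ^ N * u → θ (U (g (θ w))) = θ u :=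
    fun w u h => map_eq_of_commutator_eq_pow_mul hbar_central hbar_regular (θ : R →+* R₀) θ_ker
      (ι_comm z) (hg (θ w)) (hU _) h
  let D : R₀ →ₗ[k] R₀ :=
    { toFun := fun y => θ (U (g y))
      map_add' := fun x y => by
        have h := spec (g x + g y) (U (g x) + U (g y)) (by
          rw [mul_add (hbar ^ N), ← hU, ← hU]; noncomm_ring)
        simpa only [map_add, hg] using h
      map_smul' := fun a x => by
        have h := spec (a • g x) (a • U (g x)) (by
          rw [mul_smul_comm, mul_smul_comm, smul_mul_assoc, ← smul_sub, hU])
        simpa only [map_smul, hg, RingHom.id_apply] using h }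
  refine ⟨D, ⟨spec, fun x y => ?_⟩, fun E hE => LinearMap.ext fun y => ?_⟩
  · have h := spec (g x * g y) (U (g x) * g y + g x * U (g y)) (by
      rw [mul_add (hbar ^ N), ← mul_assoc (hbar ^ N), ← mul_assoc (hbar ^ N) (g x), pow_central (g x),
        mul_assoc (g x) (hbar ^ N), ← hU, ← hU]
      noncomm_ring)
    simp only [map_add, map_mul, hg] at h
    exact h
  · have h := hE.1 (g y) (U (g y)) (hU _)
    rwa [hg] at h
end

section
/- The bracket on Z(R₀) defined by {z, z'} := θ(u), where u ∈ R is the unique element with [ι(z), ι(z')] = ħ^N·u, makes Z(R₀) a Poisson algebra: it is k-bilinear, antisymmetric ({z,z'} = −{z',z}), satisfies the Leibniz rule {z, z'z''} = {z,z'}z'' + z'{z,z''}, and satisfies the Jacobi identity {z,{z',z''}} + {z',{z'',z}} + {z'',{z,z'}} = 0 for all z, z', z'' ∈ Z(R₀). -/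
/-- The bracket `{z, z'} := θ(u)`, where `u` is the unique element of `R` with
`[ι(z), ι(z')] = ħ^N · u`, makes the center `Z(R₀)` a Poisson algebra: there is a
bracket `B : Z(R₀) → Z(R₀) → Z(R₀)` satisfying the defining property which is
`k`-bilinear, antisymmetric, satisfies the Leibniz rule and the Jacobi identity. -/
theorem special_bracket_is_poisson
    (k : Type*) [Field k] [IsAlgClosed k] [CharZero k]
    (R R₀ : Type*) [Ring R] [Algebra k R] [Ring R₀] [Algebra k R₀]
    (hbar : R)
    (hbar_central : ∀ r : R, hbar * r = r * hbar)
    (hbar_regular : ∀ r : R, hbar * r = 0 → r = 0)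
    (θ : R →ₐ[k] R₀)
    (θ_surj : Function.Surjective θ)
    (θ_ker : ∀ r : R, θ r = 0 ↔ ∃ s : R, r = hbar * s)
    (N : ℕ) (hN : 0 < N)
    (ι : ↥(Subalgebra.center k R₀) →ₗ[k] R)
    (ι_section : ∀ z : ↥(Subalgebra.center k R₀), θ (ι z) = (z : R₀))
    (ι_comm : ∀ (z : ↥(Subalgebra.center k R₀)) (r : R),
      ∃ u : R, ι z * r - r * ι z = hbar ^ N * u) :
    ∃ B : ↥(Subalgebra.center k R₀) → ↥(Subalgebra.center k R₀) → ↥(Subalgebra.center k R₀),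
      -- defining property: `B z z' = θ u` whenever `[ι(z), ι(z')] = ħ^N · u`
      (∀ (z z' : ↥(Subalgebra.center k R₀)) (u : R),
        ι z * ι z' - ι z' * ι z = hbar ^ N * u → (B z z' : R₀) = θ u) ∧
      -- k-bilinearity
      (∀ (α : k) (z₁ z₂ z' : ↥(Subalgebra.center k R₀)),
        B (α • z₁ + z₂) z' = α • B z₁ z' + B z₂ z') ∧
      (∀ (α : k) (z z'₁ z'₂ : ↥(Subalgebra.center k R₀)),
        B z (α • z'₁ + z'₂) = α • B z z'₁ + B z z'₂) ∧
      -- antisymmetry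
      (∀ z z' : ↥(Subalgebra.center k R₀), B z z' = - B z' z) ∧
      -- Leibniz rule
      (∀ z z' z'' : ↥(Subalgebra.center k R₀),
        B z (z' * z'') = B z z' * z'' + z' * B z z'') ∧
      -- Jacobi identity
      (∀ z z' z'' : ↥(Subalgebra.center k R₀),
        B z (B z' z'') + B z' (B z'' z) + B z'' (B z z') = 0) := by
  have hbarN_central : ∀ r : R, hbar ^ N * r = r * hbar ^ N := fun r =>
    (Commute.pow_left (hbar_central r) N).eq
  have hbarN_cancel : ∀ a b : R, hbar ^ N * a = hbar ^ N * b → a = b := fun _ _ h =>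
    ((isLeftRegular_iff_right_eq_zero_of_mul.2 hbar_regular).pow N) h
  have θ_hbar : θ hbar = 0 := (θ_ker _).2 ⟨1, by simp⟩
  choose D hD using ι_comm
  have D_mul : ∀ z a b, D z (a * b) = D z a * b + a * D z b := by
    intro z a b
    apply hbarN_cancel
    rw [← hD, mul_add, ← mul_assoc _ (D z a), ← hD, ← mul_assoc (hbar ^ N) a, hbarN_central a,
      mul_assoc a (hbar ^ N), ← hD]
    noncomm_ring
  have D_smul_add : ∀ z (α : k) a b, D z (α • a + b) = α • D z a + D z b := by
    intro z α a b
    apply hbarN_cancel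
    rw [← hD, mul_add (hbar ^ N), mul_smul_comm, ← hD, ← hD]
    simp only [mul_add, add_mul, mul_smul_comm, smul_mul_assoc, smul_sub]
    abel
  have D_add : ∀ z a b, D z (a + b) = D z a + D z b := by
    intro z a b
    simpa using D_smul_add z 1 a b
  have D_hbar : ∀ z a, D z (hbar * a) = hbar * D z a := by
    intro z a
    have h : D z hbar = 0 := by
      apply hbarN_cancel
      rw [← hD, hbar_central, sub_self, mul_zero]
    rw [D_mul, h, zero_mul, zero_add]
  have θ_D_congr : ∀ z a b, θ a = θ b → θ (D z a) = θ (D z b) := by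
    intro z a b hab
    obtain ⟨s, hs⟩ := (θ_ker (a - b)).1 (by rw [map_sub, hab, sub_self])
    rw [sub_eq_iff_eq_add.1 hs, D_add, D_hbar, map_add, map_mul, θ_hbar, zero_mul, zero_add]
  have ι_comm_θ : ∀ (z : ↥(Subalgebra.center k R₀)) (a : R), θ (ι z) * θ a = θ a * θ (ι z) := by
    intro z a
    rw [ι_section]
    exact ((Subalgebra.mem_center_iff.1 z.2) (θ a)).symm
  have D_central : ∀ z z', θ (D z (ι z')) ∈ Subalgebra.center k R₀ := by
    intro z z'
    rw [Subalgebra.mem_center_iff]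
    intro b
    obtain ⟨r, rfl⟩ := θ_surj b
    have h := θ_D_congr z (ι z' * r) (r * ι z') (by simp only [map_mul, ι_comm_θ])
    simp only [D_mul, map_add, map_mul, ι_comm_θ] at h
    rw [add_comm (θ (D z r) * _)] at h
    exact (add_right_cancel h).symm
  have θ_D : ∀ z z' u, ι z * ι z' - ι z' * ι z = hbar ^ N * u → θ (D z (ι z')) = θ u := by
    intro z z' u hu
    rw [hD] at hu
    rw [hbarN_cancel _ _ hu]
  refine ⟨fun z z' => ⟨θ (D z (ι z')), D_central z z'⟩, θ_D, ?_, ?_, ?_, ?_, ?_⟩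
  · intro α z₁ z₂ z'
    apply Subtype.ext
    have h : D (α • z₁ + z₂) (ι z') = α • D z₁ (ι z') + D z₂ (ι z') := by
      apply hbarN_cancel
      rw [← hD, mul_add, mul_smul_comm, ← hD, ← hD]
      simp only [map_add, map_smul, mul_add, add_mul, mul_smul_comm, smul_mul_assoc, smul_sub]
      abel
    simp [h]
  · intro α z z'₁ z'₂
    apply Subtype.ext
    simp [D_smul_add]
  · intro z z'
    apply Subtype.ext
    have h : D z (ι z') = -D z' (ι z) := by
      apply hbarN_cancel
      rw [← hD, mul_neg, ← hD, neg_sub]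
    simp [h]
  · intro z z' z''
    apply Subtype.ext
    have h := θ_D_congr z (ι (z' * z'')) (ι z' * ι z'') (by simp [ι_section])
    simp [h, D_mul, ι_section]
  · intro z z' z''
    apply Subtype.ext
    have hB : ∀ x y w, θ (D x (ι ⟨θ (D y (ι w)), D_central y w⟩)) = θ (D x (D y (ι w))) :=
      fun x y w => θ_D_congr x _ _ (ι_section _)
    have hDD : ∀ x y w, hbar ^ N * (hbar ^ N * D x (D y (ι w))) =
        ι x * (ι y * ι w - ι w * ι y) - (ι y * ι w - ι w * ι y) * ι x := by
      intro x y w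
      rw [← hD x, hD y, mul_sub, ← mul_assoc, hbarN_central, mul_assoc, mul_assoc]
    have h : D z (D z' (ι z'')) + D z' (D z'' (ι z)) + D z'' (D z (ι z')) = 0 := by
      apply hbarN_cancel
      apply hbarN_cancel
      simp only [mul_add, hDD, mul_zero]
      noncomm_ring
    simpa [hB] using congrArg θ h
end

section
/- Let C be a k-subalgebra of Z(R₀) such that the restriction of ι to C is an algebra homomorphism (ι(1) = 1 and ι(c·c') = ι(c)·ι(c') for all c, c' ∈ C). Then for all z, z' ∈ C and w ∈ R₀ one has ∂_{z·z'}(w) = z·∂_{z'}(w) + z'·∂_z(w), where the multiplication is that of R₀. -/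
/-- If `C` is a `k`-subalgebra of `Z(R₀)` on which the section `ι` is an algebra
homomorphism, then the special derivations of level `N` satisfy
`∂_{z·z'}(w) = z·∂_{z'}(w) + z'·∂_z(w)` for all `z, z' ∈ C` and `w ∈ R₀`. -/
theorem special_derivation_multiplicative_on_subalgebra
    (k : Type*) [Field k] [IsAlgClosed k] [CharZero k]
    (R R₀ : Type*) [Ring R] [Algebra k R] [Ring R₀] [Algebra k R₀]
    (hbar : R)
    (hbar_central : ∀ r : R, hbar * r = r * hbar)
    (hbar_regular : ∀ r : R, hbar * r = 0 → r = 0)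
    (θ : R →ₐ[k] R₀)
    (θ_surj : Function.Surjective θ)
    (θ_ker : ∀ r : R, θ r = 0 ↔ ∃ s : R, r = hbar * s)
    (N : ℕ) (hN : 0 < N)
    (ι : ↥(Subalgebra.center k R₀) →ₗ[k] R)
    (ι_section : ∀ z : ↥(Subalgebra.center k R₀), θ (ι z) = (z : R₀))
    (ι_comm : ∀ (z : ↥(Subalgebra.center k R₀)) (r : R),
      ∃ u : R, ι z * r - r * ι z = hbar ^ N * u)
    (D : ↥(Subalgebra.center k R₀) → R₀ → R₀)
    (hD : ∀ (z : ↥(Subalgebra.center k R₀)) (w u : R),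
      ι z * w - w * ι z = hbar ^ N * u → D z (θ w) = θ u)
    (C : Subalgebra k ↥(Subalgebra.center k R₀))
    (ι_one : ι 1 = 1)
    (ι_mul : ∀ z z' : ↥(Subalgebra.center k R₀), z ∈ C → z' ∈ C → ι (z * z') = ι z * ι z') :
    ∀ z z' : ↥(Subalgebra.center k R₀), z ∈ C → z' ∈ C → ∀ w : R₀,
      D (z * z') w = (z : R₀) * D z' w + (z' : R₀) * D z w := by
  intro z z' hz hz' w
  obtain ⟨r, rfl⟩ := θ_surj w
  obtain ⟨u, hu⟩ := ι_comm z r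
  obtain ⟨u', hu'⟩ := ι_comm z' r
  have hpow : Commute (ι z) (hbar ^ N) :=
    Commute.pow_right (hbar_central (ι z)).symm N
  have leibniz : ι (z * z') * r - r * ι (z * z') = hbar ^ N * (ι z * u' + u * ι z') := by
    calc ι (z * z') * r - r * ι (z * z')
        = ι z * (ι z' * r - r * ι z') + (ι z * r - r * ι z) * ι z' := by
          rw [ι_mul z z' hz hz']; noncomm_ring
      _ = hbar ^ N * (ι z * u' + u * ι z') := by
          rw [hu, hu', ← mul_assoc, hpow.eq, mul_add, mul_assoc, mul_assoc]
  have hcomm : θ u * (z' : R₀) = (z' : R₀) * θ u :=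
    Subalgebra.mem_center_iff.mp z'.2 (θ u)
  rw [hD _ r _ leibniz, hD z r u hu, hD z' r u' hu', map_add, map_mul, map_mul,
    ι_section, ι_section, hcomm]
end

section
/- The element g := c(c³−b³)·y³ + b(c³−a³)·yxz + a(b³−c³)·xyz + c(a³−c³)·x³ of S = S(a,b,c) is central (g·s = s·g for all s ∈ S) and regular (g·s = 0 implies s = 0, and s·g = 0 implies s = 0). -/
noncomputable section

/-- The defining relations of the 3-dimensional Sklyanin algebra `S(a,b,c)`:
`a·yz + b·zy + c·x²`, `a·zx + b·xz + c·y²`, `a·xy + b·yx + c·z²` are set to zero.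
The generators `x, y, z` are the images of `FreeAlgebra.ι k 0, 1, 2`. -/
inductive SklyaninRel (k : Type*) [CommRing k] (a b c : k) :
    FreeAlgebra k (Fin 3) → FreeAlgebra k (Fin 3) → Prop
  | r1 : SklyaninRel k a b c
      (a • (FreeAlgebra.ι k 1 * FreeAlgebra.ι k 2) + b • (FreeAlgebra.ι k 2 * FreeAlgebra.ι k 1)
        + c • (FreeAlgebra.ι k 0 * FreeAlgebra.ι k 0)) 0
  | r2 : SklyaninRel k a b c
      (a • (FreeAlgebra.ι k 2 * FreeAlgebra.ι k 0) + b • (FreeAlgebra.ι k 0 * FreeAlgebra.ι k 2)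
        + c • (FreeAlgebra.ι k 1 * FreeAlgebra.ι k 1)) 0
  | r3 : SklyaninRel k a b c
      (a • (FreeAlgebra.ι k 0 * FreeAlgebra.ι k 1) + b • (FreeAlgebra.ι k 1 * FreeAlgebra.ι k 0)
        + c • (FreeAlgebra.ι k 2 * FreeAlgebra.ι k 2)) 0

/-- The 3-dimensional Sklyanin algebra `S(a,b,c)`: the quotient of the free algebra
`k⟨x,y,z⟩` by the two-sided ideal generated by the three Sklyanin relations. -/
def Sklyanin (k : Type*) [CommRing k] (a b c : k) : Type _ := RingQuot (SklyaninRel k a b c)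

instance (k : Type*) [CommRing k] (a b c : k) : Ring (Sklyanin k a b c) := by
  unfold Sklyanin; infer_instance

instance (k : Type*) [CommRing k] (a b c : k) : Algebra k (Sklyanin k a b c) := by
  unfold Sklyanin; infer_instance

namespace Sklyanin

variable (k : Type*) [CommRing k] (a b c : k)

/-- The generator `x` of `S(a,b,c)`. -/
def X : Sklyanin k a b c := RingQuot.mkAlgHom k (SklyaninRel k a b c) (FreeAlgebra.ι k 0)
/-- The generator `y` of `S(a,b,c)`. -/
def Y : Sklyanin k a b c := RingQuot.mkAlgHom k (SklyaninRel k a b c) (FreeAlgebra.ι k 1)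
/-- The generator `z` of `S(a,b,c)`. -/
def Z : Sklyanin k a b c := RingQuot.mkAlgHom k (SklyaninRel k a b c) (FreeAlgebra.ι k 2)

/-- The canonical central element
`g = c(c³−b³)y³ + b(c³−a³)yxz + a(b³−c³)xyz + c(a³−c³)x³` of `S(a,b,c)`. -/
def g : Sklyanin k a b c :=
  (c * (c ^ 3 - b ^ 3)) • (Y k a b c * Y k a b c * Y k a b c)
    + (b * (c ^ 3 - a ^ 3)) • (Y k a b c * X k a b c * Z k a b c)
    + (a * (b ^ 3 - c ^ 3)) • (X k a b c * Y k a b c * Z k a b c)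
    + (c * (a ^ 3 - c ^ 3)) • (X k a b c * X k a b c * X k a b c)

end Sklyanin

universe u

/-- A `k`-algebra `S` with three elements `x 0, x 1, x 2` is a model of `S(a,b,c)` if these
elements generate `S`, satisfy the Sklyanin relations, and have the universal property. -/
structure IsSklyanin {k : Type u} [CommRing k] (a b c : k) {S : Type u} [Ring S] [Algebra k S]
    (x : Fin 3 → S) : Prop where
  rel : ∀ i, a • (x (i + 1) * x (i + 2)) + b • (x (i + 2) * x (i + 1)) + c • (x i * x i) = 0
  induction : ∀ (P : S → Prop) (algebra_map : ∀ r, P (algebraMap k S r)) (gen : ∀ i, P (x i))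
    (add : ∀ s t, P s → P t → P (s + t)) (mul : ∀ s t, P s → P t → P (s * t)) s, P s
  exists_lift : ∀ {A : Type u} [Ring A] [Algebra k A] (f : Fin 3 → A),
    (∀ i, a • (f (i + 1) * f (i + 2)) + b • (f (i + 2) * f (i + 1)) + c • (f i * f i) = 0) →
    ∃ φ : S →ₐ[k] A, ∀ i, φ (x i) = f i

namespace Sklyanin

section API

variable {k : Type u} [CommRing k] {a b c : k}

/-- The three generators of `S(a,b,c)`, indexed by `Fin 3`. -/
def gen (k : Type u) [CommRing k] (a b c : k) (i : Fin 3) : Sklyanin k a b c :=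
  RingQuot.mkAlgHom k (SklyaninRel k a b c) (FreeAlgebra.ι k i)

lemma gen_rel (i : Fin 3) :
    a • (gen k a b c (i + 1) * gen k a b c (i + 2))
      + b • (gen k a b c (i + 2) * gen k a b c (i + 1))
      + c • (gen k a b c i * gen k a b c i) = 0 := by
  have h : ∀ u, SklyaninRel k a b c u 0 → RingQuot.mkAlgHom k (SklyaninRel k a b c) u = 0 := by
    intro u hu
    rw [RingQuot.mkAlgHom_rel k hu, map_zero]
  fin_cases i
  · have := h _ SklyaninRel.r1
    simp only [map_add, map_smul, map_mul] at this
    exact this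
  · have := h _ SklyaninRel.r2
    simp only [map_add, map_smul, map_mul] at this
    exact this
  · have := h _ SklyaninRel.r3
    simp only [map_add, map_smul, map_mul] at this
    exact this

lemma gen_exists_lift {A : Type u} [Ring A] [Algebra k A] (f : Fin 3 → A)
    (hf : ∀ i, a • (f (i + 1) * f (i + 2)) + b • (f (i + 2) * f (i + 1)) + c • (f i * f i) = 0) :
    ∃ φ : Sklyanin k a b c →ₐ[k] A, ∀ i, φ (gen k a b c i) = f i := by
  have hrel : ∀ ⦃u v⦄, SklyaninRel k a b c u v →
      FreeAlgebra.lift k f u = FreeAlgebra.lift k f v := by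
    intro u v huv
    cases huv
    · simpa using hf 0
    · simpa using hf 1
    · simpa using hf 2
  refine ⟨RingQuot.liftAlgHom k ⟨FreeAlgebra.lift k f, hrel⟩, fun i => ?_⟩
  exact (RingQuot.liftAlgHom_mkAlgHom_apply k (s := SklyaninRel k a b c) (FreeAlgebra.lift k f)
    hrel (FreeAlgebra.ι k i)).trans (FreeAlgebra.lift_ι_apply f i)

lemma gen_induction (P : Sklyanin k a b c → Prop) (halg : ∀ r, P (algebraMap k _ r))
    (hgen : ∀ i, P (gen k a b c i)) (hadd : ∀ s t, P s → P t → P (s + t))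
    (hmul : ∀ s t, P s → P t → P (s * t)) (s : Sklyanin k a b c) : P s := by
  obtain ⟨u, rfl⟩ := RingQuot.mkAlgHom_surjective k (SklyaninRel k a b c) s
  refine FreeAlgebra.induction k (Fin 3)
    (motive := fun u => P (RingQuot.mkAlgHom k (SklyaninRel k a b c) u)) ?_ hgen ?_ ?_ u
  · intro r
    have := halg r
    rw [AlgHom.commutes]
    exact this
  · intro u v hu hv
    have := hmul _ _ hu hv
    rw [map_mul]
    exact this
  · intro u v hu hv
    have := hadd _ _ hu hv
    rw [map_add]
    exact this

lemma isSklyanin_gen (k : Type u) [CommRing k] (a b c : k) : IsSklyanin a b c (gen k a b c) where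
  rel := gen_rel
  induction := gen_induction
  exists_lift := gen_exists_lift

end API

end Sklyanin

namespace IsSklyanin

section Grading

variable {k : Type u} [CommRing k] {a b c : k} {S : Type u} [Ring S] [Algebra k S] {x : Fin 3 → S}

/-- The space of linear forms in the generators `x 0, x 1, x 2`. -/
def V (k : Type u) [CommRing k] {S : Type u} [Ring S] [Algebra k S] (x : Fin 3 → S) :
    Submodule k S :=
  Submodule.span k (Set.range x)

lemma gen_mem (i : Fin 3) : x i ∈ V k x :=
  Submodule.subset_span ⟨i, rfl⟩

lemma mul_mem_pow {m n : ℕ} {s t : S} (hs : s ∈ V k x ^ m) (ht : t ∈ V k x ^ n) :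
    s * t ∈ V k x ^ (m + n) := by
  rw [pow_add]
  exact Submodule.mul_mem_mul hs ht

lemma gen_mul_mem {n : ℕ} (i : Fin 3) {s : S} (hs : s ∈ V k x ^ n) :
    x i * s ∈ V k x ^ (n + 1) := by
  rw [pow_succ']
  exact Submodule.mul_mem_mul (gen_mem i) hs

lemma mul_gen_mem {n : ℕ} (i : Fin 3) {s : S} (hs : s ∈ V k x ^ n) :
    s * x i ∈ V k x ^ (n + 1) := by
  rw [pow_succ]
  exact Submodule.mul_mem_mul hs (gen_mem i)

lemma mem_V_iff {v : S} : v ∈ V k x ↔ ∃ l : Fin 3 → k, ∑ i, l i • x i = v := by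
  rw [V, Submodule.mem_span_range_iff_exists_fun]

lemma mem_pow_succ_iff {n : ℕ} {s : S} :
    s ∈ V k x ^ (n + 1) ↔
      ∃ t : Fin 3 → S, (∀ i, t i ∈ V k x ^ n) ∧ ∑ i, t i * x i = s := by
  constructor
  · intro hs
    rw [pow_succ] at hs
    induction hs using Submodule.mul_induction_on' with
    | mem_mul_mem u hu v hv =>
      obtain ⟨l, rfl⟩ := mem_V_iff.1 hv
      exact ⟨fun i => l i • u, fun i => Submodule.smul_mem _ _ hu, by
        simp [Finset.mul_sum]⟩
    | add u _ v _ hu hv =>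
      obtain ⟨t, ht, rfl⟩ := hu
      obtain ⟨t', ht', rfl⟩ := hv
      exact ⟨fun i => t i + t' i, fun i => Submodule.add_mem _ (ht i) (ht' i), by
        simp [add_mul, Finset.sum_add_distrib]⟩
  · rintro ⟨t, ht, rfl⟩
    exact Submodule.sum_mem _ fun i _ => mul_gen_mem i (ht i)

lemma algHom_ext (h : IsSklyanin a b c x) {A : Type*} [Ring A] [Algebra k A] {φ ψ : S →ₐ[k] A}
    (hφ : ∀ i, φ (x i) = ψ (x i)) : φ = ψ := by
  ext s
  induction s using h.induction with
  | algebra_map r => simp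
  | gen i => exact hφ i
  | add s t hs ht => simp [hs, ht]
  | mul s t hs ht => simp [hs, ht]

open Polynomial in
lemma exists_gradingHom (h : IsSklyanin a b c x) :
    ∃ φ : S →ₐ[k] S[X], ∀ i, φ (x i) = monomial 1 (x i) :=
  h.exists_lift (fun i => monomial 1 (x i)) (by
    intro i
    simp only [monomial_mul_monomial, smul_monomial, ← map_add, h.rel, map_zero])

open Polynomial in
/-- The homomorphism `S → S[t]` with `x i ↦ x i t`, encoding the grading of `S`. -/
def gradingHom (h : IsSklyanin a b c x) : S →ₐ[k] S[X] := h.exists_gradingHom.choose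

lemma gradingHom_gen (h : IsSklyanin a b c x) (i : Fin 3) :
    h.gradingHom (x i) = Polynomial.monomial 1 (x i) := h.exists_gradingHom.choose_spec i

/-- The projection of `S` to its component of degree `n`. -/
def proj (h : IsSklyanin a b c x) (n : ℕ) : S →ₗ[k] S where
  toFun s := (h.gradingHom s).coeff n
  map_add' s t := by simp
  map_smul' r s := by simp

variable (h : IsSklyanin a b c x)
include h

lemma gradingHom_of_mem {n : ℕ} {s : S} (hs : s ∈ V k x ^ n) :
    h.gradingHom s = Polynomial.monomial n s := by
  induction n generalizing s with
  | zero =>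
    rw [pow_zero, Submodule.mem_one] at hs
    obtain ⟨r, rfl⟩ := hs
    rw [AlgHom.commutes]
    rfl
  | succ n ih =>
    obtain ⟨t, ht, rfl⟩ := mem_pow_succ_iff.1 hs
    simp only [map_sum, map_mul, ih (ht _), gradingHom_gen, Polynomial.monomial_mul_monomial]

lemma proj_mul_right {m : ℕ} (n : ℕ) (s : S) {t : S} (ht : t ∈ V k x ^ m) :
    h.proj (n + m) (s * t) = h.proj n s * t := by
  change (h.gradingHom (s * t)).coeff (n + m) = (h.gradingHom s).coeff n * t
  rw [map_mul, h.gradingHom_of_mem ht, Polynomial.coeff_mul_monomial]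

lemma proj_mul_left {m : ℕ} (n : ℕ) {s : S} (t : S) (hs : s ∈ V k x ^ m) :
    h.proj (n + m) (s * t) = s * h.proj n t := by
  change (h.gradingHom (s * t)).coeff (n + m) = s * (h.gradingHom t).coeff n
  rw [map_mul, h.gradingHom_of_mem hs, Polynomial.coeff_monomial_mul]

lemma proj_of_mem {n : ℕ} {s : S} (hs : s ∈ V k x ^ n) : h.proj n s = s := by
  change (h.gradingHom s).coeff n = s
  rw [h.gradingHom_of_mem hs, Polynomial.coeff_monomial_same]

lemma proj_mem (n : ℕ) (s : S) : h.proj n s ∈ V k x ^ n := by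
  change (h.gradingHom s).coeff n ∈ V k x ^ n
  induction s using h.induction generalizing n with
  | algebra_map r =>
    rw [AlgHom.commutes, Polynomial.algebraMap_apply, Polynomial.coeff_C]
    split_ifs with hn
    · subst hn
      rw [pow_zero]
      exact Submodule.algebraMap_mem r
    · exact zero_mem _
  | gen i =>
    rw [gradingHom_gen, Polynomial.coeff_monomial]
    split_ifs with hn
    · subst hn
      rw [pow_one]
      exact gen_mem i
    · exact zero_mem _
  | add s t hs ht =>
    rw [map_add, Polynomial.coeff_add]
    exact add_mem (hs n) (ht n)
  | mul s t hs ht =>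
    rw [map_mul, Polynomial.coeff_mul]
    refine Submodule.sum_mem _ fun y hy => ?_
    rw [← Finset.HasAntidiagonal.mem_antidiagonal.1 hy]
    exact mul_mem_pow (hs _) (ht _)

lemma eq_zero_of_proj {s : S} (hs : ∀ n, h.proj n s = 0) : s = 0 := by
  have h0 : h.gradingHom s = 0 := Polynomial.ext hs
  let ψ : Polynomial S →ₐ[k] S :=
    Polynomial.eval₂AlgHom (AlgHom.id k _) 1 (fun _ => Commute.one_right _)
  have hψ : ψ.comp h.gradingHom = AlgHom.id k _ := by
    apply h.algHom_ext
    intro i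
    simp [ψ, gradingHom_gen]
  have := DFunLike.congr_fun hψ s
  simpa [h0] using this.symm

end Grading

instance pow_finite {k : Type u} [CommRing k] {S : Type u} [Ring S] [Algebra k S] (x : Fin 3 → S)
    (n : ℕ) : Module.Finite k ↥(V k x ^ n) := by
  rw [Module.Finite.iff_fg]
  exact Submodule.FG.pow (Submodule.fg_span (Set.finite_range _)) n

section Koszul

variable {k : Type u} [CommRing k] {S : Type u} [Ring S] [Algebra k S]

/-- The second differential of the Koszul complex of `S(a,b,c)`. -/
def kosz (a b c : k) (x : Fin 3 → S) : (Fin 3 → S) →ₗ[S] (Fin 3 → S) where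
  toFun t j := a • (t (j + 1) * x (j + 2)) + b • (t (j + 2) * x (j + 1)) + c • (t j * x j)
  map_add' t u := by
    ext j
    simp only [Pi.add_apply, add_mul, smul_add]
    abel
  map_smul' r t := by
    ext j
    simp [mul_add, mul_assoc]

variable {a b c : k} {x : Fin 3 → S}

lemma kosz_apply (t : Fin 3 → S) (j : Fin 3) : kosz a b c x t j =
    a • (t (j + 1) * x (j + 2)) + b • (t (j + 2) * x (j + 1)) + c • (t j * x j) := rfl

lemma kosz_gen (h : IsSklyanin a b c x) (s : S) : kosz a b c x (fun i => s * x i) = 0 := by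
  ext j
  have := congrArg (s * ·) (h.rel j)
  simpa [kosz_apply, mul_add, mul_assoc] using this

lemma sum_smul_eq_zero (h : IsSklyanin a b c x) {P : Type u} [AddCommGroup P] [Module S P]
    [Module k P] [IsScalarTower k S P] {e : Fin 3 → P}
    (he : ∀ i, a • (x (i + 1) • e (i + 2)) + b • (x (i + 2) • e (i + 1)) + c • (x i • e i) = 0)
    {s : Fin 3 → S} (hs : ∑ i, s i * x i = 0) : ∑ i, s i • e i = 0 := by
  let f : Fin 3 → Module.End k (P × k) := fun i =>
    { toFun := fun p => (x i • p.1 + p.2 • e i, 0)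
      map_add' := fun p q => by
        ext
        · simp only [Prod.fst_add, Prod.snd_add, smul_add, add_smul]
          abel
        · simp
      map_smul' := fun r p => by
        ext
        · simp [smul_comm r, mul_smul]
        · simp }
  have hfa : ∀ i p, f i p = (x i • p.1 + p.2 • e i, 0) := fun i p => rfl
  have hf : ∀ i, a • (f (i + 1) * f (i + 2)) + b • (f (i + 2) * f (i + 1)) + c • (f i * f i) =
      0 := by
    intro i
    refine LinearMap.ext fun p => Prod.ext ?_ ?_
    · have h1 := congrArg (· • p.1) (h.rel i)
      have h2 := he i
      simp only [add_smul, smul_assoc, mul_smul, zero_smul] at h1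
      simp only [LinearMap.add_apply, LinearMap.smul_apply, Module.End.mul_apply, hfa,
        Prod.fst_add, Prod.smul_fst, smul_add, zero_smul, add_zero, LinearMap.zero_apply,
        Prod.fst_zero]
      have hc : ∀ j l, x j • (p.2 • e l) = p.2 • (x j • e l) := fun j l => smul_comm _ _ _
      rw [hc, hc, hc]
      generalize x (i + 1) • x (i + 2) • p.1 = u₁, x (i + 2) • x (i + 1) • p.1 = u₂,
        x i • x i • p.1 = u₃, x (i + 1) • e (i + 2) = v₁, x (i + 2) • e (i + 1) = v₂,
        x i • e i = v₃ at h1 h2 ⊢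
      linear_combination (norm := module) h1 + p.2 • h2
    · simp [hfa]
  obtain ⟨φ, hφ⟩ := h.exists_lift f hf
  have hφ1 : ∀ s p, φ s (p, 0) = (s • p, 0) := by
    intro s
    induction s using h.induction with
    | algebra_map r =>
      intro p
      rw [AlgHom.commutes]
      simp [Module.algebraMap_end_apply]
    | gen i =>
      intro p
      simp [hφ, hfa]
    | add s t hs ht =>
      intro p
      simp [hs, ht, add_smul]
    | mul s t hs ht =>
      intro p
      simp [hs, ht, mul_smul]
  have h0 : φ (∑ i, s i * x i) (0, 1) = (∑ i, s i • e i, 0) := by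
    have hx : ∀ i, φ (x i) (0, 1) = (e i, 0) := fun i => by simp [hφ, hfa]
    simp only [map_sum, map_mul, LinearMap.sum_apply, Module.End.mul_apply, hx, hφ1]
    ext
    · simp [Prod.fst_sum]
    · simp [Prod.snd_sum]
  rw [hs, map_zero, LinearMap.zero_apply] at h0
  exact (congrArg Prod.fst h0).symm

/-- Exactness of the Koszul complex at its second to last place: the relations among right
multiples of the generators are generated by the defining relations. -/
lemma exists_kosz_eq (h : IsSklyanin a b c x) {s : Fin 3 → S} (hs : ∑ i, s i * x i = 0) :
    ∃ t, kosz a b c x t = s := by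
  let N := LinearMap.range (kosz a b c x)
  have h0 := h.sum_smul_eq_zero (P := (Fin 3 → S) ⧸ N)
    (e := fun i => N.mkQ (Pi.single i 1)) (fun i => ?_) hs
  · have h1 : N.mkQ s = 0 := by
      rw [← h0]
      simp only [← map_smul, ← map_sum]
      congr 1
      ext j
      simp [Finset.sum_apply, Pi.single_apply]
    exact (Submodule.Quotient.mk_eq_zero _).1 h1
  · have h1 : N.mkQ (kosz a b c x (Pi.single i 1)) = 0 :=
      (Submodule.Quotient.mk_eq_zero _).2 (LinearMap.mem_range_self _ _)
    rw [← h1]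
    simp only [← map_smul, ← LinearMap.map_smul_of_tower, ← map_add]
    congr 1
    ext j
    simp only [kosz_apply]
    fin_cases i <;> fin_cases j <;> simp

end Koszul

end IsSklyanin

namespace IsSklyanin

section Central

variable {k : Type u} [CommRing k] {a b c : k} {S : Type u} [Ring S] [Algebra k S] {x : Fin 3 → S}

/-- The canonical central element of degree three. -/
def cubic (a b c : k) (x : Fin 3 → S) : S :=
  (c * (c ^ 3 - b ^ 3)) • (x 1 * x 1 * x 1) + (b * (c ^ 3 - a ^ 3)) • (x 1 * x 0 * x 2)
    + (a * (b ^ 3 - c ^ 3)) • (x 0 * x 1 * x 2) + (c * (a ^ 3 - c ^ 3)) • (x 0 * x 0 * x 0)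

lemma cubic_mul_gen (h : IsSklyanin a b c x) (i : Fin 3) :
    cubic a b c x * x i = x i * cubic a b c x := by
  have h0 := h.rel 0
  have h1 := h.rel 1
  have h2 := h.rel 2
  simp only [Fin.isValue, Fin.reduceAdd] at h0 h1 h2
  rw [← sub_eq_zero]
  fin_cases i <;> simp only [Fin.zero_eta, Fin.mk_one, Fin.reduceFinMk, Fin.isValue, cubic]
  · linear_combination (norm := skip) (c ^ 3) • (x 1 * h1 * x 0) + (a * b * c) • (x 1 * h2 * x 1)
      + (a ^ 2 * b) • (h2 * x 0 * x 2) - (a ^ 2 * b) • (x 1 * x 0 * h1)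
      - (a * c ^ 2) • (x 1 * x 2 * h0) - (b ^ 2 * c) • (x 1 * x 1 * h2)
      - (a * b * c) • (x 2 * h1 * x 2) + (a * c ^ 2) • (h0 * x 1 * x 2)
      - (c ^ 3) • (x 0 * x 1 * h1) + (b ^ 3) • (x 0 * x 1 * h1)
      + (b ^ 2 * c) • (h1 * x 2 * x 2) - (b ^ 3) • (x 0 * h2 * x 2)
    simp only [mul_add, add_mul, smul_mul_assoc, mul_smul_comm, mul_assoc, mul_zero, zero_mul]
    module
  · linear_combination (norm := skip) -(a * b * c) • (x 0 * h2 * x 0) - (c ^ 3) • (x 0 * h0 * x 1)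
      - (b * c ^ 2) • (h1 * x 0 * x 2) + (b * c ^ 2) • (x 0 * x 2 * h1)
      + (a ^ 2 * c) • (x 0 * x 0 * h2) + (a * b * c) • (x 2 * h0 * x 2)
      + (a * b ^ 2) • (x 0 * x 1 * h0) - (a * b ^ 2) • (h2 * x 1 * x 2)
      + (c ^ 3) • (x 1 * x 0 * h0) - (a ^ 3) • (x 1 * x 0 * h0)
      - (a ^ 2 * c) • (h0 * x 2 * x 2) + (a ^ 3) • (x 1 * h2 * x 2)
    simp only [mul_add, add_mul, smul_mul_assoc, mul_smul_comm, mul_assoc, mul_zero, zero_mul]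
    module
  · linear_combination (norm := skip) -(a ^ 2 * c) • (h1 * x 0 * x 0)
      + (a * b * c) • (x 0 * h1 * x 0)
      + (a ^ 2 * c) • (x 1 * x 1 * h0) + (a * c ^ 2) • (h2 * x 0 * x 1)
      - (a * c ^ 2) • (x 0 * x 1 * h2) - (a * b * c) • (x 1 * h0 * x 1)
      - (c ^ 3) • (h0 * x 0 * x 2) + (c ^ 3) • (x 1 * h1 * x 2)
      + (b ^ 3) • (x 0 * h0 * x 2) + (a ^ 3) • (h0 * x 0 * x 2)
      - (a ^ 3) • (x 1 * h1 * x 2) + (b ^ 2 * c) • (h0 * x 1 * x 1)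
      - (b ^ 2 * c) • (x 0 * x 0 * h1) + (c ^ 3) • (x 2 * x 0 * h0)
      - (b ^ 3) • (h1 * x 1 * x 2) - (c ^ 3) • (x 2 * h1 * x 1)
    simp only [mul_add, add_mul, smul_mul_assoc, mul_smul_comm, mul_assoc, mul_zero, zero_mul]
    module

lemma cubic_mul (h : IsSklyanin a b c x) (s : S) :
    cubic a b c x * s = s * cubic a b c x := by
  induction s using h.induction with
  | algebra_map r => exact (Algebra.commutes r _).symm
  | gen i => exact h.cubic_mul_gen i
  | add s t hs ht => rw [mul_add, add_mul, hs, ht]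
  | mul s t hs ht => rw [← mul_assoc, hs, mul_assoc, ht, mul_assoc]

lemma cubic_mem : cubic a b c x ∈ V k x ^ 3 := by
  have h3 : ∀ i j l, x i * x j * x l ∈ V k x ^ 3 := fun i j l => by
    refine mul_gen_mem (n := 2) l (mul_gen_mem (n := 1) j ?_)
    rw [pow_one]
    exact gen_mem i
  exact add_mem (add_mem (add_mem (Submodule.smul_mem _ _ (h3 _ _ _))
    (Submodule.smul_mem _ _ (h3 _ _ _))) (Submodule.smul_mem _ _ (h3 _ _ _)))
    (Submodule.smul_mem _ _ (h3 _ _ _))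

end Central

end IsSklyanin

namespace IsSklyanin

section Relations

/-- The `i`-th defining relation of `S(a,b,c)`, with the coefficient vector `q` in the left
factor and the vectors `n` in the right factor. -/
def relForm {k N : Type*} [CommRing k] [AddCommGroup N] [Module k N] (a b c : k) (q : Fin 3 → k)
    (n : Fin 3 → N) (i : Fin 3) : N :=
  (a * q (i + 1)) • n (i + 2) + (b * q (i + 2)) • n (i + 1) + (c * q i) • n i

/-- The `(i, j)` entry of the matrix of the linear map `relForm a b c q`. -/
def relMatrix {k : Type*} [CommRing k] (a b c : k) (q : Fin 3 → k) : Matrix (Fin 3) (Fin 3) k :=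
  !![c * q 0, b * q 2, a * q 1; a * q 2, c * q 1, b * q 0; b * q 1, a * q 0, c * q 2]

/-- The adjugate of the matrix `relMatrix a b c q`. -/
def relAdj {k : Type*} [CommRing k] (a b c : k) (q : Fin 3 → k) : Fin 3 → Fin 3 → k :=
  ![![c ^ 2 * q 1 * q 2 - a * b * q 0 ^ 2, a ^ 2 * q 1 * q 0 - b * c * q 2 ^ 2,
      b ^ 2 * q 2 * q 0 - a * c * q 1 ^ 2],
    ![b ^ 2 * q 0 * q 1 - a * c * q 2 ^ 2, c ^ 2 * q 2 * q 0 - a * b * q 1 ^ 2,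
      a ^ 2 * q 2 * q 1 - b * c * q 0 ^ 2],
    ![a ^ 2 * q 0 * q 2 - b * c * q 1 ^ 2, b ^ 2 * q 1 * q 2 - a * c * q 0 ^ 2,
      c ^ 2 * q 0 * q 1 - a * b * q 2 ^ 2]]

/-- The equation of the point scheme of `S(a,b,c)`. -/
def OnCurve {k : Type*} [CommRing k] (a b c : k) (q : Fin 3 → k) : Prop :=
  a * b * c * (q 0 ^ 3 + q 1 ^ 3 + q 2 ^ 3) = (a ^ 3 + b ^ 3 + c ^ 3) * (q 0 * q 1 * q 2)

variable {k : Type*} [CommRing k] {a b c : k}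

lemma relAdj_smul {N : Type*} [AddCommGroup N] [Module k N] {q : Fin 3 → k} {n : Fin 3 → N}
    (hn : ∀ i, relForm a b c q n i = 0) (i j l : Fin 3) :
    relAdj a b c q j l • n i = relAdj a b c q i l • n j := by
  have key : ∀ i, relAdj a b c q (i + 1) l • n i = relAdj a b c q i l • n (i + 1) := by
    intro i
    have h1 := congrArg (relMatrix a b c q (l + 1) (i + 2) • ·) (hn (l + 2))
    have h2 := congrArg (relMatrix a b c q (l + 2) (i + 2) • ·) (hn (l + 1))
    simp only [smul_zero] at h1 h2
    rw [← sub_eq_zero]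
    refine Eq.trans ?_ ((congrArg₂ (· - ·) h1 h2).trans (sub_zero 0))
    fin_cases i <;> fin_cases l <;> simp [relMatrix, relAdj, relForm] <;> module
  have h3 : j = i ∨ j = i + 1 ∨ i = j + 1 := by revert i j; decide
  rcases h3 with rfl | rfl | rfl
  · rfl
  · exact key i
  · exact (key j).symm

lemma relAdj_swap (q : Fin 3 → k) (i j : Fin 3) : relAdj b a c q i j = relAdj a b c q j i := by
  fin_cases i <;> fin_cases j <;> simp [relAdj] <;> ring

lemma relForm_swap (p q : Fin 3 → k) (i : Fin 3) : relForm b a c q p i = relForm a b c p q i := by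
  simp only [relForm, smul_eq_mul]
  ring

lemma relAdj_mul {p q : Fin 3 → k} (hp : ∀ i, relForm a b c p q i = 0) (i j l : Fin 3) :
    relAdj a b c q l j * p i = relAdj a b c q l i * p j := by
  have := relAdj_smul (a := b) (b := a) (c := c) (q := q) (n := p)
    (fun i => (relForm_swap p q i).trans (hp i)) i j l
  simpa only [relAdj_swap, smul_eq_mul] using this

lemma det_relMatrix (q : Fin 3 → k) : (relMatrix a b c q).det =
    (a ^ 3 + b ^ 3 + c ^ 3) * (q 0 * q 1 * q 2) - a * b * c * (q 0 ^ 3 + q 1 ^ 3 + q 2 ^ 3) := by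
  rw [relMatrix, Matrix.det_fin_three]
  simp only [Matrix.cons_val', Matrix.cons_val_zero, Matrix.cons_val_one, Matrix.cons_val,
    Matrix.of_apply]
  ring

lemma relMatrix_mulVec (q r : Fin 3 → k) : (relMatrix a b c q).mulVec r = relForm a b c q r := by
  ext i
  fin_cases i <;> simp [relMatrix, relForm, Matrix.mulVec, dotProduct, Fin.sum_univ_three] <;> ring

lemma OnCurve.swap {q : Fin 3 → k} (hq : OnCurve a b c q) : OnCurve b a c q := by
  unfold OnCurve at *
  linear_combination hq

end Relations

section Points

variable {k : Type*} [Field k] {a b c : k}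

lemma onCurve_iff {q : Fin 3 → k} :
    OnCurve a b c q ↔ ∃ r : Fin 3 → k, r ≠ 0 ∧ ∀ i, relForm a b c q r i = 0 := by
  have h1 := Matrix.exists_mulVec_eq_zero_iff (M := relMatrix a b c q)
  simp only [det_relMatrix, relMatrix_mulVec, sub_eq_zero, funext_iff, Pi.zero_apply] at h1
  rw [OnCurve, eq_comm, ← h1]

lemma OnCurve.exists_succ {q : Fin 3 → k} (hq : OnCurve a b c q) :
    ∃ r : Fin 3 → k, r ≠ 0 ∧ ∀ i, relForm a b c q r i = 0 := onCurve_iff.1 hq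

lemma OnCurve.exists_pred {q : Fin 3 → k} (hq : OnCurve a b c q) :
    ∃ p : Fin 3 → k, p ≠ 0 ∧ ∀ i, relForm a b c p q i = 0 := by
  obtain ⟨p, hp, h⟩ := hq.swap.exists_succ
  exact ⟨p, hp, fun i => (relForm_swap p q i).symm.trans (h i)⟩

lemma onCurve_left {q r : Fin 3 → k} (hr : r ≠ 0) (h : ∀ i, relForm a b c q r i = 0) :
    OnCurve a b c q := onCurve_iff.2 ⟨r, hr, h⟩

lemma onCurve_right {q r : Fin 3 → k} (hq : q ≠ 0) (h : ∀ i, relForm a b c q r i = 0) :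
    OnCurve a b c r :=
  (onCurve_left (a := b) (b := a) hq fun i => (relForm_swap q r i).trans (h i)).swap

lemma exists_relAdj_ne_zero (ha : a ≠ 0) (hb : b ≠ 0)
    (habc : ¬(a ^ 3 = b ^ 3 ∧ b ^ 3 = c ^ 3)) {q : Fin 3 → k} (hq : q ≠ 0) :
    ∃ j l, relAdj a b c q j l ≠ 0 := by
  by_contra! hall
  have e : ∀ j l, relAdj a b c q j l = 0 := hall
  have e00 := e 0 0
  have e11 := e 1 1
  have e22 := e 2 2
  have e10 := e 1 0
  have e01 := e 0 1
  simp only [relAdj, Matrix.cons_val', Matrix.cons_val_zero, Matrix.cons_val_one, Matrix.cons_val,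
    Matrix.cons_val_fin_one] at e00 e11 e22 e10 e01
  have hab : a * b ≠ 0 := mul_ne_zero ha hb
  by_cases h : q 0 = 0 ∨ q 1 = 0
  · apply hq
    have h2 : q 2 = 0 := by
      have : a * b * q 2 ^ 2 = 0 := by
        rcases h with h | h <;> rw [h] at e22 <;> linear_combination -e22
      simpa [ha, hb] using this
    rw [h2] at e00 e11
    have h0 : a * b * q 0 ^ 2 = 0 := by linear_combination -e00
    have h1 : a * b * q 1 ^ 2 = 0 := by linear_combination -e11
    ext i
    fin_cases i
    · simpa [ha, hb] using h0
    · simpa [ha, hb] using h1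
    · exact h2
  · push Not at h
    have hm : q 0 * q 1 * a ≠ 0 := mul_ne_zero (mul_ne_zero h.1 h.2) ha
    have hm' : q 0 * q 1 * b ≠ 0 := mul_ne_zero (mul_ne_zero h.1 h.2) hb
    have h1 : q 0 * q 1 * a * (b ^ 3 - c ^ 3) = 0 := by
      linear_combination a * b * e10 - a * c * e22
    have h2 : q 0 * q 1 * b * (a ^ 3 - c ^ 3) = 0 := by
      linear_combination a * b * e01 - b * c * e22
    have h3 := sub_eq_zero.1 ((mul_eq_zero.1 h1).resolve_left hm)
    have h4 := sub_eq_zero.1 ((mul_eq_zero.1 h2).resolve_left hm')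
    exact habc ⟨h4.trans h3.symm, h3⟩

/-- The element `cubic` vanishes on consecutive points. -/
lemma cubic_eval (ha : a ≠ 0) (hb : b ≠ 0)
    (habc : ¬(a ^ 3 = b ^ 3 ∧ b ^ 3 = c ^ 3)) {p q r : Fin 3 → k} (hq : q ≠ 0)
    (hpq : ∀ i, relForm a b c p q i = 0) (hqr : ∀ i, relForm a b c q r i = 0) :
    c * (c ^ 3 - b ^ 3) * (p 1 * q 1 * r 1) + b * (c ^ 3 - a ^ 3) * (p 1 * q 0 * r 2)
      + a * (b ^ 3 - c ^ 3) * (p 0 * q 1 * r 2) + c * (a ^ 3 - c ^ 3) * (p 0 * q 0 * r 0) = 0 := by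
  obtain ⟨m, l, hml⟩ := exists_relAdj_ne_zero ha hb habc hq
  have key : ∀ i j, relAdj a b c q m l * (p i * r j) = r m * p l * relAdj a b c q j i := by
    intro i j
    have h1 := relAdj_mul hpq i l m
    have h2 := relAdj_smul hqr j m i
    simp only [smul_eq_mul] at h2
    linear_combination r j * h1 + p l * h2
  refine (mul_eq_zero.1 ?_).resolve_left hml
  have h11 := key 1 1
  have h12 := key 1 2
  have h02 := key 0 2
  have h00 := key 0 0
  generalize relAdj a b c q m l = d at *
  simp only [relAdj, Matrix.cons_val', Matrix.cons_val_zero, Matrix.cons_val_one, Matrix.cons_val,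
    Matrix.cons_val_fin_one] at h11 h12 h02 h00
  linear_combination c * (c ^ 3 - b ^ 3) * q 1 * h11 + b * (c ^ 3 - a ^ 3) * q 0 * h12
    + a * (b ^ 3 - c ^ 3) * q 1 * h02 + c * (a ^ 3 - c ^ 3) * q 0 * h00

end Points

end IsSklyanin

namespace IsSklyanin

/-- A bi-infinite sequence of points such that consecutive points satisfy the (multilinearized)
Sklyanin relations; it corresponds to a point module of `S(a,b,c)`. -/
structure PointChain {k : Type*} [Field k] (a b c : k) where
  /-- The sequence of points. -/
  pt : ℤ → Fin 3 → k
  ne_zero : ∀ n, pt n ≠ 0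
  rel : ∀ n i, relForm a b c (pt n) (pt (n + 1)) i = 0

variable {k : Type u} [Field k] {a b c : k}

lemma OnCurve.exists_pointChain {q : Fin 3 → k} (hq : q ≠ 0) (h : OnCurve a b c q) :
    ∃ P : PointChain a b c, P.pt 0 = q := by
  let T := {q : Fin 3 → k // q ≠ 0 ∧ OnCurve a b c q}
  have hs : ∀ q : T, ∃ r : T, ∀ i, relForm a b c q.1 r.1 i = 0 := fun q => by
    obtain ⟨r, hr, hrel⟩ := q.2.2.exists_succ
    exact ⟨⟨r, hr, onCurve_right q.2.1 hrel⟩, hrel⟩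
  have hp : ∀ q : T, ∃ p : T, ∀ i, relForm a b c p.1 q.1 i = 0 := fun q => by
    obtain ⟨p, hp, hrel⟩ := q.2.2.exists_pred
    exact ⟨⟨p, hp, onCurve_left q.2.1 hrel⟩, hrel⟩
  choose σ hσ using hs
  choose τ hτ using hp
  let f : ℤ → T
    | Int.ofNat n => σ^[n] ⟨q, hq, h⟩
    | Int.negSucc n => τ^[n + 1] ⟨q, hq, h⟩
  refine ⟨⟨fun n => (f n).1, fun n => (f n).2.1, fun n i => ?_⟩, rfl⟩
  match n with
  | Int.ofNat n =>
    have : f (Int.ofNat n + 1) = σ (f (Int.ofNat n)) := Function.iterate_succ_apply' σ n _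
    rw [this]
    exact hσ _ i
  | Int.negSucc 0 =>
    have : f (Int.negSucc 0) = τ (f (Int.negSucc 0 + 1)) := rfl
    rw [this]
    exact hτ _ i
  | Int.negSucc (n + 1) =>
    have : f (Int.negSucc (n + 1)) = τ (f (Int.negSucc (n + 1) + 1)) :=
      Function.iterate_succ_apply' τ (n + 1) _
    rw [this]
    exact hτ _ i

namespace PointChain

lemma exists_coord_ne_zero (P : PointChain a b c) (n : ℤ) : ∃ i, P.pt n i ≠ 0 :=
  Function.ne_iff.1 (P.ne_zero n)

end PointChain

section Evaluation

variable {S : Type u} [Ring S] [Algebra k S] {x : Fin 3 → S} (h : IsSklyanin a b c x)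
  (P : PointChain a b c)
include h

lemma exists_act : ∃ φ : S →ₐ[k] Module.End k (ℤ → k),
    ∀ i f j, φ (x i) f j = P.pt j i * f (j + 1) := by
  let f : Fin 3 → Module.End k (ℤ → k) := fun i =>
    { toFun := fun f j => P.pt j i * f (j + 1)
      map_add' := fun f g => by
        ext j
        simp [mul_add]
      map_smul' := fun r f => by
        ext j
        simp [mul_left_comm] }
  have hfa : ∀ i g j, f i g j = P.pt j i * g (j + 1) := fun _ _ _ => rfl
  obtain ⟨φ, hφ⟩ := h.exists_lift f (fun i => by
    ext1 g
    ext j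
    have := P.rel j i
    simp only [relForm, smul_eq_mul] at this
    simp only [LinearMap.add_apply, LinearMap.smul_apply, Module.End.mul_apply, Pi.add_apply,
      Pi.smul_apply, hfa, smul_eq_mul, LinearMap.zero_apply, Pi.zero_apply]
    linear_combination g (j + 1 + 1) * this)
  exact ⟨φ, fun i g j => by rw [hφ, hfa]⟩

/-- The action of `S` on the (extended) point module of a chain. -/
def act : S →ₐ[k] Module.End k (ℤ → k) := (h.exists_act P).choose

lemma act_gen (i : Fin 3) (f : ℤ → k) (j : ℤ) :
    h.act P (x i) f j = P.pt j i * f (j + 1) := (h.exists_act P).choose_spec i f j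

/-- Evaluation of (multilinearized) elements of `S` along a chain of points, starting at the
point with index `j`. -/
def ev (j : ℤ) : S →ₗ[k] k where
  toFun s := h.act P s 1 j
  map_add' s t := by simp
  map_smul' r s := by simp

lemma ev_apply (j : ℤ) (s : S) : h.ev P j s = h.act P s 1 j := rfl

lemma ev_gen (i : Fin 3) (j : ℤ) : h.ev P j (x i) = P.pt j i := by
  rw [ev_apply, act_gen, Pi.one_apply, mul_one]

lemma ev_one (j : ℤ) : h.ev P j 1 = 1 := by
  change h.act P 1 1 j = 1
  rw [map_one (h.act P)]
  rfl

lemma act_of_mem {m : ℕ} {s : S} (hs : s ∈ V k x ^ m) (f : ℤ → k) (j : ℤ) :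
    h.act P s f j = h.ev P j s * f (j + m) := by
  induction m generalizing s f with
  | zero =>
    rw [pow_zero, Submodule.mem_one] at hs
    obtain ⟨r, rfl⟩ := hs
    simp [ev_apply, Module.algebraMap_end_apply]
  | succ m ih =>
    obtain ⟨t, ht, rfl⟩ := mem_pow_succ_iff.1 hs
    simp only [ev_apply, map_sum, map_mul, LinearMap.sum_apply, Finset.sum_apply,
      Module.End.mul_apply, Finset.sum_mul]
    refine Finset.sum_congr rfl fun i _ => ?_
    rw [ih (ht i), ih (ht i), act_gen, act_gen, Pi.one_apply, mul_one, mul_assoc, Nat.cast_succ,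
      add_assoc]

lemma ev_mul {m : ℕ} {s : S} (hs : s ∈ V k x ^ m) (t : S) (j : ℤ) :
    h.ev P j (s * t) = h.ev P j s * h.ev P (j + m) t := by
  rw [ev_apply, map_mul, Module.End.mul_apply, h.act_of_mem P hs, h.ev_apply P _ t]

lemma ev_gen_mul (i : Fin 3) (t : S) (j : ℤ) :
    h.ev P j (x i * t) = P.pt j i * h.ev P (j + 1) t := by
  rw [ev_apply, map_mul, Module.End.mul_apply, act_gen, ev_apply]

lemma exists_ev_ne_zero (n : ℕ) (j : ℤ) : ∃ s ∈ V k x ^ n, h.ev P j s ≠ 0 := by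
  induction n with
  | zero => exact ⟨1, by rw [pow_zero]; exact Submodule.one_le.1 le_rfl, by simp [ev_one]⟩
  | succ n ih =>
    obtain ⟨s, hs, hne⟩ := ih
    obtain ⟨i, hi⟩ := P.exists_coord_ne_zero (j + n)
    refine ⟨s * x i, mul_gen_mem i hs, ?_⟩
    rw [h.ev_mul P hs, ev_gen]
    exact mul_ne_zero hne hi

lemma ev_cubic (ha : a ≠ 0) (hb : b ≠ 0) (habc : ¬(a ^ 3 = b ^ 3 ∧ b ^ 3 = c ^ 3)) (j : ℤ) :
    h.ev P j (cubic a b c x) = 0 := by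
  have h3 : ∀ i l m, h.ev P j (x i * x l * x m) =
      P.pt j i * P.pt (j + 1) l * P.pt (j + 1 + 1) m := fun i l m => by
    rw [mul_assoc, ev_gen_mul, ev_gen_mul, ev_gen, mul_assoc]
  simp only [cubic, map_add, map_smul, h3, smul_eq_mul]
  exact cubic_eval ha hb habc (P.ne_zero _) (P.rel _) (P.rel _)

end Evaluation

end IsSklyanin

namespace IsSklyanin

section RootsOfPlaneSections

lemma exists_sq_add_add_one_eq_zero (k : Type*) [Field k] [IsAlgClosed k] [CharZero k] :
    ∃ ω : k, 1 + ω + ω ^ 2 = 0 := by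
  obtain ⟨s, hs⟩ := IsAlgClosed.exists_pow_nat_eq (-3 : k) (n := 2) (by norm_num)
  refine ⟨(s - 1) / 2, ?_⟩
  field_simp
  linear_combination hs

lemma ne_one_of_sq_add_add_one {k : Type*} [Field k] [CharZero k] {ω : k}
    (hω : 1 + ω + ω ^ 2 = 0) : ω ≠ 1 := by
  rintro rfl
  norm_num at hω

/-- All but finitely many lines `y = t z` meet the curve in three points. -/
lemma exists_three_onCurve {k : Type*} [Field k] [IsAlgClosed k] [CharZero k] {a b c : k}
    (ha : a ≠ 0) (hb : b ≠ 0) (hc : c ≠ 0) (B : Finset k) :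
    ∃ t ∉ B, ∃ e : Fin 3 → k, Function.Injective e ∧ ∀ i, OnCurve a b c ![e i, t, 1] := by
  classical
  have hm : a * b * c ≠ 0 := mul_ne_zero (mul_ne_zero ha hb) hc
  let D : Polynomial k :=
    4 * Polynomial.C (a * b * c * (a ^ 3 + b ^ 3 + c ^ 3) ^ 3) * Polynomial.X ^ 3
      - 27 * Polynomial.C ((a * b * c) ^ 4) * (Polynomial.X ^ 3 + 1) ^ 2
  have hD : D ≠ 0 := by
    intro h0
    have : D.eval 0 = 0 := by rw [h0, Polynomial.eval_zero]
    simp [D, ha, hb, hc] at this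
  obtain ⟨t, ht⟩ := Infinite.exists_notMem_finset (B ∪ D.roots.toFinset)
  simp only [Finset.mem_union, Multiset.mem_toFinset, Polynomial.mem_roots hD, not_or,
    Polynomial.IsRoot.def] at ht
  refine ⟨t, ht.1, ?_⟩
  let P : Cubic k := ⟨a * b * c, 0, -((a ^ 3 + b ^ 3 + c ^ 3) * t), a * b * c * (t ^ 3 + 1)⟩
  have hPa : P.a ≠ 0 := hm
  have hdisc : P.discr ≠ 0 := by
    have : P.discr = D.eval t := by
      simp [P, D, Cubic.discr]
      ring
    rw [this]
    exact ht.2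
  have hsplit : (P.toPoly.map (RingHom.id k)).Splits := IsAlgClosed.splits _
  obtain ⟨r₀, r₁, r₂, hr⟩ := (Cubic.splits_iff_roots_eq_three hPa).1 hsplit
  obtain ⟨h01, h02, h12⟩ := (Cubic.discr_ne_zero_iff_roots_ne hPa hr).1 hdisc
  have hmap : Cubic.map (RingHom.id k) P = P := rfl
  rw [hmap] at hr
  have hroot : ∀ r ∈ P.roots, OnCurve a b c ![r, t, 1] := by
    intro r hr
    have hP0 : P.toPoly ≠ 0 := Cubic.ne_zero_of_a_ne_zero hPa
    have := (Cubic.mem_roots_iff hP0 r).1 hr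
    simp only [P] at this
    simp only [OnCurve, Matrix.cons_val_zero, Matrix.cons_val_one, Matrix.cons_val]
    linear_combination this
  refine ⟨![r₀, r₁, r₂], ?_, ?_⟩
  · intro i j hij
    fin_cases i <;> fin_cases j <;>
      simp [h01, h02, h12, h01.symm, h02.symm, h12.symm] at hij ⊢
  · intro i
    apply hroot
    rw [hr]
    fin_cases i <;> simp

end RootsOfPlaneSections

variable {k : Type u} [Field k] {a b c : k}

lemma not_proportional_of_ne (ha : a ≠ 0) (hb : b ≠ 0) (habc : ¬(a ^ 3 = b ^ 3 ∧ b ^ 3 = c ^ 3))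
    {p p' r r' : Fin 3 → k} (hp : p 2 = 1) (hp' : p' 2 = 1) (h0 : p 0 ≠ p' 0) (hr : r ≠ 0)
    (hr' : r' ≠ 0) (hpr : ∀ i, relForm a b c p r i = 0) (hpr' : ∀ i, relForm a b c p' r' i = 0) :
    ∃ i j, r i * r' j - r j * r' i ≠ 0 := by
  by_contra! hall
  obtain ⟨j, hj⟩ := Function.ne_iff.1 hr'
  have hp'r : ∀ i, relForm a b c p' r i = 0 := by
    intro i
    refine (mul_eq_zero.1 ?_).resolve_left hj
    have h1 := hpr' i
    simp only [relForm, smul_eq_mul] at h1 ⊢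
    linear_combination r j * h1 + a * p' (i + 1) * hall (i + 2) j
      + b * p' (i + 2) * hall (i + 1) j + c * p' i * hall i j
  obtain ⟨l, m, hlm⟩ := exists_relAdj_ne_zero ha hb habc hr
  have e1 := relAdj_mul hpr 2 m l
  have e2 := relAdj_mul hpr 0 2 l
  have e3 := relAdj_mul hp'r 0 2 l
  rw [hp, mul_one] at e1
  rw [hp, mul_one] at e2
  rw [hp', mul_one] at e3
  have hl2 : relAdj a b c r l 2 ≠ 0 := by
    intro h2
    rw [h2, zero_mul] at e1
    exact hlm e1
  exact h0 (mul_left_cancel₀ hl2 (e2.trans e3.symm))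

section Separation

variable {S : Type u} [Ring S] [Algebra k S] {x : Fin 3 → S} (h : IsSklyanin a b c x)
include h

lemma exists_eval_of_dual {n : ℕ} {κ : Type*} [Fintype κ] (Q : κ → PointChain a b c)
    (hQ : ∀ α, ∃ s ∈ V k x ^ n, h.ev (Q α) 0 s ≠ 0 ∧ ∀ β, β ≠ α → h.ev (Q β) 0 s = 0) (w : κ → k) :
    ∃ s ∈ V k x ^ n, ∀ α, h.ev (Q α) 0 s = w α := by
  classical
  choose s hs hne h0 using hQ
  refine ⟨∑ α, (w α / h.ev (Q α) 0 (s α)) • s α,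
    Submodule.sum_mem _ fun α _ => Submodule.smul_mem _ _ (hs α), fun β => ?_⟩
  rw [map_sum, Finset.sum_eq_single β]
  · rw [map_smul, smul_eq_mul, div_mul_cancel₀ _ (hne β)]
  · intro α _ hα
    rw [map_smul, h0 α β hα.symm, smul_zero]
  · simp

lemma exists_dual_of_line (ha : a ≠ 0) (hb : b ≠ 0) (habc : ¬(a ^ 3 = b ^ 3 ∧ b ^ 3 = c ^ 3))
    {t : k} {e : Fin 3 → k} (he : Function.Injective e) {Q : Fin 3 → PointChain a b c}
    (hQ : ∀ α, (Q α).pt 0 = ![e α, t, 1]) (m : ℕ) (α : Fin 3) :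
    ∃ s ∈ V k x ^ (m + 2), h.ev (Q α) 0 s ≠ 0 ∧ ∀ β, β ≠ α → h.ev (Q β) 0 s = 0 := by
  obtain ⟨β, γ, hβ, hγ, hall⟩ : ∃ β γ : Fin 3, β ≠ α ∧ γ ≠ α ∧ ∀ δ, δ ≠ α → δ = β ∨ δ = γ := by
    revert α
    decide
  obtain ⟨i, j, hij⟩ := not_proportional_of_ne ha hb habc (p := (Q α).pt 0) (p' := (Q γ).pt 0)
    (by simp [hQ]) (by simp [hQ]) (by simpa [hQ] using fun h => hγ (he h.symm))
    ((Q α).ne_zero (0 + 1)) ((Q γ).ne_zero (0 + 1)) ((Q α).rel 0) ((Q γ).rel 0)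
  obtain ⟨u, hu, hne⟩ := h.exists_ev_ne_zero (Q α) m (0 + 1 + 1)
  have hmem : ∀ v ∈ V k x ^ m, ∀ i j, x i * (x j * v) ∈ V k x ^ (m + 2) :=
    fun v hv i j => gen_mul_mem i (gen_mul_mem j hv)
  let r := (Q γ).pt (0 + 1)
  let ℓ : S := r j • (x i * u) - r i • (x j * u)
  have hℓ : ∀ P : PointChain a b c, h.ev P (0 + 1) ℓ =
      (P.pt (0 + 1) i * r j - P.pt (0 + 1) j * r i) * h.ev P (0 + 1 + 1) u := fun P => by
    simp only [ℓ, map_sub, map_smul, ev_gen_mul, smul_eq_mul]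
    ring
  have hev : ∀ P : PointChain a b c, h.ev P 0 (x 0 * ℓ - e β • (x 2 * ℓ)) =
      (P.pt 0 0 - e β * P.pt 0 2) * h.ev P (0 + 1) ℓ := fun P => by
    simp only [map_sub, map_smul, ev_gen_mul, smul_eq_mul]
    ring
  have hℓm : ℓ ∈ V k x ^ (m + 1) := sub_mem (Submodule.smul_mem _ _ (gen_mul_mem _ hu))
    (Submodule.smul_mem _ _ (gen_mul_mem _ hu))
  refine ⟨x 0 * ℓ - e β • (x 2 * ℓ), sub_mem (gen_mul_mem _ hℓm)
    (Submodule.smul_mem _ _ (gen_mul_mem _ hℓm)), ?_, fun δ hδ => ?_⟩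
  · rw [hev, hℓ, hQ]
    refine mul_ne_zero ?_ (mul_ne_zero hij hne)
    simpa [sub_eq_zero] using fun h => hβ (he h.symm)
  · rw [hev]
    rcases hall δ hδ with rfl | rfl
    · simp [hQ]
    · rw [hℓ]
      simp only [r]
      ring

lemma exists_separating_one [IsAlgClosed k] [CharZero k] :
    ∃ T : Fin 3 → PointChain a b c × ℤ,
      ∀ w : Fin 3 → k, ∃ s ∈ V k x ^ 1, ∀ i, h.ev (T i).1 (T i).2 s = w i := by
  obtain ⟨ω, hω⟩ := exists_sq_add_add_one_eq_zero k
  have hω1 : ω - 1 ≠ 0 := sub_ne_zero.2 (ne_one_of_sq_add_add_one hω)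
  let q : Fin 3 → Fin 3 → k := ![![0, 1, -1], ![0, 1, -ω], ![1, 0, -1]]
  have hq : ∀ i, ∃ P : PointChain a b c, P.pt 0 = q i := by
    intro i
    apply OnCurve.exists_pointChain
    · intro h0
      have h1 := congrFun h0 0
      have h2 := congrFun h0 1
      fin_cases i <;> simp [q] at h1 h2
    · have hω3 : ω ^ 3 = 1 := by linear_combination (ω - 1) * hω
      have hω3' : (-ω) ^ 3 = -1 := by linear_combination -hω3
      have h1 : (-1 : k) ^ 3 = -1 := by norm_num
      fin_cases i <;> simp [q, OnCurve, hω3', h1]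
  choose P hP using hq
  refine ⟨fun i => (P i, 0), fun w => ?_⟩
  let l : Fin 3 → k := ![w 2 + (w 0 - w 1) / (ω - 1), w 0 + (w 0 - w 1) / (ω - 1),
    (w 0 - w 1) / (ω - 1)]
  refine ⟨∑ i, l i • x i, ?_, fun i => ?_⟩
  · rw [pow_one]
    exact mem_V_iff.2 ⟨l, rfl⟩
  · simp only [map_add, map_smul, ev_gen, hP, Fin.sum_univ_three, smul_eq_mul]
    fin_cases i <;> (simp [q, l]; try field_simp; ring)

/-- For every `n` there are `3 (n + 1)` truncated point modules which impose independent
conditions on forms of degree `n + 1`. -/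
lemma exists_separating [IsAlgClosed k] [CharZero k] (ha : a ≠ 0) (hb : b ≠ 0) (hc : c ≠ 0)
    (habc : ¬(a ^ 3 = b ^ 3 ∧ b ^ 3 = c ^ 3)) (n : ℕ) :
    ∃ (ι : Type) (_ : Fintype ι) (T : ι → PointChain a b c × ℤ), Fintype.card ι = 3 * (n + 1) ∧
      ∀ w : ι → k, ∃ s ∈ V k x ^ (n + 1), ∀ i, h.ev (T i).1 (T i).2 s = w i := by
  classical
  induction n with
  | zero =>
    obtain ⟨T, hT⟩ := h.exists_separating_one
    exact ⟨Fin 3, inferInstance, T, by simp, hT⟩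
  | succ n ih =>
    obtain ⟨ι, _, T, hcard, hT⟩ := ih
    let p : ι → Fin 3 → k := fun i => (T i).1.pt ((T i).2 - 1)
    obtain ⟨t, ht, e, he, hcurve⟩ := exists_three_onCurve ha hb hc
      (Finset.univ.image fun i => p i 1 / p i 2)
    have hq : ∀ α, ∃ Q : PointChain a b c, Q.pt 0 = ![e α, t, 1] := fun α =>
      (hcurve α).exists_pointChain fun h0 => by simpa using congrFun h0 2
    choose Q hQ using hq
    have hline : ∀ i, p i 1 - t * p i 2 ≠ 0 := by
      intro i h0
      by_cases hz : p i 2 = 0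
      · have h1 : p i 1 = 0 := by simpa [hz] using h0
        have hp : p i ≠ 0 := (T i).1.ne_zero _
        have hcv : OnCurve a b c (p i) := onCurve_left ((T i).1.ne_zero _) ((T i).1.rel _)
        apply hp
        simp only [OnCurve, hz, h1] at hcv
        ext l
        fin_cases l
        · simpa [ha, hb, hc] using hcv
        · exact h1
        · exact hz
      · apply ht
        rw [Finset.mem_image]
        exact ⟨i, Finset.mem_univ _, by rw [div_eq_iff hz]; linear_combination h0⟩
    refine ⟨ι ⊕ Fin 3, inferInstance,
      Sum.elim (fun i => ((T i).1, (T i).2 - 1)) (fun α => (Q α, 0)), ?_, fun w => ?_⟩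
    · rw [Fintype.card_sum, hcard, Fintype.card_fin]
      ring
    · obtain ⟨s₂, hs₂, hw₂⟩ := h.exists_eval_of_dual Q (n := n + 2)
        (h.exists_dual_of_line ha hb habc he hQ n) (fun α => w (Sum.inr α))
      obtain ⟨s₁, hs₁, hw₁⟩ := hT fun i =>
        (w (Sum.inl i) - h.ev (T i).1 ((T i).2 - 1) s₂) / (p i 1 - t * p i 2)
      refine ⟨s₂ + (x 1 * s₁ - t • (x 2 * s₁)), add_mem hs₂ (sub_mem (gen_mul_mem _ hs₁)
        (Submodule.smul_mem _ _ (gen_mul_mem _ hs₁))), ?_⟩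
      have hev : ∀ (P : PointChain a b c) j, h.ev P j (x 1 * s₁ - t • (x 2 * s₁)) =
          (P.pt j 1 - t * P.pt j 2) * h.ev P (j + 1) s₁ := fun P j => by
        simp only [map_sub, map_smul, ev_gen_mul, smul_eq_mul]
        ring
      rintro (i | α)
      · simp only [Sum.elim_inl, map_add, hev, sub_add_cancel, hw₁]
        have := hline i
        simp only [p] at this ⊢
        rw [mul_div_cancel₀ _ this]
        ring
      · simp [hev, hw₂, hQ]

end Separation

end IsSklyanin

namespace IsSklyanin

section CubicIdentities

variable {k : Type u} [CommRing k] {a b c : k} {S : Type u} [Ring S] [Algebra k S] {x : Fin 3 → S}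

/-- The product of the linear forms `y + z` and `aωx - cy` generates a truncated point module
modulo the right ideal generated by `x` and the central cubic element. -/
lemma cubic_point_identities (h : IsSklyanin a b c x) {ω : k} (hω : 1 + ω + ω ^ 2 = 0) :
    (∃ s : S, ∃ r : k, (c * ω * (b ^ 3 - a ^ 3)) • ((x 1 + x 2) * ((a * ω) • x 0 - c • x 1) * x 1)
      - (b * (a ^ 3 - c ^ 3)) • ((x 1 + x 2) * ((a * ω) • x 0 - c • x 1) * x 0)
      = x 0 * s + r • cubic a b c x) ∧
    (∃ s : S, ∃ r : k, (b * (c * ω * (b ^ 3 - a ^ 3))) •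
      ((x 1 + x 2) * ((a * ω) • x 0 - c • x 1) * x 2)
      - (b * (a * ω ^ 2 * (c ^ 3 - b ^ 3))) • ((x 1 + x 2) * ((a * ω) • x 0 - c • x 1) * x 0)
      = x 0 * s + r • cubic a b c x) ∧
    (∃ s : S, ∃ r : k, (b * (a ^ 3 - c ^ 3)) • ((x 1 + x 2) * ((a * ω) • x 0 - c • x 1) * x 2)
      - (a * ω ^ 2 * (c ^ 3 - b ^ 3)) • ((x 1 + x 2) * ((a * ω) • x 0 - c • x 1) * x 1)
      = x 0 * s + r • cubic a b c x) := by
  have h0 := h.rel 0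
  have h1 := h.rel 1
  have h2 := h.rel 2
  simp only [Fin.isValue, Fin.reduceAdd] at h0 h1 h2
  have hN : ∀ s : S, (1 + ω + ω ^ 2) • s = 0 := fun s => by rw [hω, zero_smul]
  refine ⟨?_, ?_, ?_⟩
  · refine ⟨(-2 * a ^ 3 * c ^ 2 * ω ^ 2 - a ^ 3 * c ^ 2 * ω - a ^ 3 * c ^ 2
      + b ^ 3 * c ^ 2 * ω ^ 2 + c ^ 5 * ω ^ 2 + c ^ 5 * ω + c ^ 5) • (x 0 * x 0)
      + (-a ^ 3 * b ^ 2 * ω + b ^ 2 * c ^ 3 * ω) • (x 0 * x 1)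
      + (-a ^ 2 * b ^ 3 * ω + a ^ 2 * c ^ 3 * ω + a ^ 2 * c ^ 3) • (x 0 * x 2)
      + (a ^ 5 * ω - a ^ 2 * b ^ 3 * ω) • (x 1 * x 0) + (a ^ 2 * b ^ 2 * c) • (x 1 * x 1)
      + (-a ^ 4 * c * ω ^ 2 - a * b ^ 3 * c * ω + a * c ^ 4 * ω ^ 2 + a * c ^ 4 * ω) • (x 1 * x 2)
      + (b ^ 2 * c ^ 3) • (x 2 * x 0),
      c * ω ^ 2 + c * ω, ?_⟩
    linear_combination (norm := skip) (a ^ 3 * c - c ^ 4) • (h0 * x 0)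
      + (-b ^ 2 * c ^ 2 * ω) • (h0 * x 1)
      + (-a ^ 2 * c ^ 2 * ω - a ^ 2 * c ^ 2) • (h0 * x 2)
      + (-a ^ 3 * b * ω - b * c ^ 3) • (h1 * x 0)
      + (-a ^ 3 * c * ω ^ 2 + b ^ 3 * c * ω ^ 2) • (h1 * x 1)
      + (-a ^ 2 * b * c * ω) • (h1 * x 2) + (-a ^ 4 * ω) • (h2 * x 0)
      + (-a * b ^ 2 * c * ω - a * b ^ 2 * c) • (h2 * x 1)
      + (a ^ 3 * c * ω ^ 2 - b ^ 3 * c * ω ^ 2) • (x 0 * h0) + (a ^ 2 * b ^ 2 * ω) • (x 0 * h1)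
      + (a ^ 2 * b ^ 2 * ω) • (x 0 * h2) + (a * b * c ^ 2 * ω) • (x 1 * h0)
      + (-a ^ 3 * c + c ^ 4) • (x 1 * h1) + (a ^ 3 * c * ω + a ^ 3 * c) • (x 1 * h2)
      + (a * b * c ^ 2 * ω + a * b * c ^ 2) • (x 2 * h0) + (a ^ 3 * c * ω) • (x 2 * h1)
      + (-a ^ 4 * c + a * b ^ 3 * c) • hN (x 1 * x 0 * x 1)
      + (a ^ 3 * b * c - b * c ^ 4) • hN (x 1 * x 0 * x 2)
      + (a ^ 3 * c ^ 2 - c ^ 5) • hN (x 1 * x 1 * x 1)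
    simp only [cubic, mul_add, add_mul, mul_sub, sub_mul, smul_mul_assoc, mul_smul_comm, mul_assoc,
      mul_zero, zero_mul]
    module
  · refine ⟨(-a ^ 4 * c ^ 2 * ω ^ 2 + a * b ^ 3 * c ^ 2 * ω ^ 2) • (x 0 * x 0)
      + (-a ^ 4 * b ^ 2 * ω ^ 2 - a * b ^ 5 * ω + a * b ^ 2 * c ^ 3 * ω ^ 2
        + a * b ^ 2 * c ^ 3 * ω) • (x 0 * x 1)
      + (b ^ 6 - b ^ 3 * c ^ 3) • (x 0 * x 2) + (a ^ 3 * b ^ 3 * ω - b ^ 6 * ω) • (x 1 * x 0)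
      + (a ^ 3 * b ^ 2 * c * ω + b ^ 5 * c - b ^ 2 * c ^ 4 * ω - b ^ 2 * c ^ 4) • (x 1 * x 1)
      + (-a ^ 2 * b ^ 3 * c * ω ^ 2 + a ^ 2 * c ^ 4 * ω ^ 2) • (x 1 * x 2),
      a * c * ω ^ 2, ?_⟩
    linear_combination (norm := skip) (-a * b ^ 3 * c * ω ^ 2 + a * c ^ 4 * ω ^ 2) • (h0 * x 0)
      + (-a * b ^ 2 * c ^ 2 * ω ^ 2 - a * b ^ 2 * c ^ 2 * ω) • (h0 * x 1)
      + (-b ^ 3 * c ^ 2 * ω) • (h0 * x 2)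
      + (a * b ^ 4 - a * b * c ^ 3 * ω - a * b * c ^ 3) • (h1 * x 0)
      + (-a ^ 3 * b * c * ω ^ 2 - b ^ 4 * c * ω) • (h1 * x 2)
      + (-a ^ 2 * b ^ 3 * ω ^ 2 - a ^ 2 * b ^ 3 * ω) • (h2 * x 0)
      + (-a ^ 2 * b ^ 2 * c * ω) • (h2 * x 1)
      + (-b ^ 5 + b ^ 2 * c ^ 3 * ω + b ^ 2 * c ^ 3) • (x 0 * h1)
      + (a ^ 3 * b ^ 2 * ω ^ 2 + b ^ 5 * ω) • (x 0 * h2)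
      + (a ^ 2 * b * c ^ 2 * ω ^ 2 + a ^ 2 * b * c ^ 2 * ω) • (x 1 * h0)
      + (a * b ^ 3 * c * ω ^ 2 - a * c ^ 4 * ω ^ 2) • (x 1 * h1)
      + (a * b ^ 3 * c * ω) • (x 1 * h2) + (a ^ 2 * b * c ^ 2 * ω) • (x 2 * h0)
      + (a * b ^ 3 * c * ω ^ 2 + a * b ^ 3 * c * ω) • (x 2 * h1)
      + (a ^ 2 * b ^ 4 * ω - a ^ 2 * b * c ^ 3 * ω) • hN (x 1 * x 0 * x 0)
      + (-a * b ^ 4 * c + a * b * c ^ 4) • hN (x 1 * x 1 * x 0)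
      + (a ^ 2 * b ^ 4 * ω - a ^ 2 * b ^ 4 - a ^ 2 * b * c ^ 3 * ω
        + a ^ 2 * b * c ^ 3) • hN (x 2 * x 0 * x 0)
    simp only [cubic, mul_add, add_mul, mul_sub, sub_mul, smul_mul_assoc, mul_smul_comm, mul_assoc,
      mul_zero, zero_mul]
    module
  · refine ⟨(-a ^ 4 * c * ω ^ 2 - a ^ 4 * c + a * b ^ 3 * c + a * c ^ 4 * ω ^ 2) • (x 0 * x 0)
      + (-a * b ^ 2 * c ^ 2 * ω) • (x 0 * x 1) + (b ^ 3 * c ^ 2 - c ^ 5) • (x 0 * x 2)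
      + (a ^ 3 * c ^ 2 * ω ^ 2 - b ^ 3 * c ^ 2 * ω ^ 2 - b ^ 3 * c ^ 2 * ω) • (x 1 * x 0)
      + (-a ^ 3 * b ^ 2 + b ^ 2 * c ^ 3) • (x 1 * x 1)
      + (-a ^ 2 * b ^ 3 * ω ^ 2 + a ^ 2 * c ^ 3 * ω ^ 2) • (x 1 * x 2)
      + (-a ^ 3 * b ^ 2 * ω) • (x 2 * x 2),
      a * ω ^ 2 + a, ?_⟩
    linear_combination (norm := skip) (-a * b ^ 2 * c * ω ^ 2) • (h0 * x 1) + (c ^ 4) • (h0 * x 2)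
      + (a * b * c ^ 2) • (h1 * x 0) + (a * b ^ 3 - a * c ^ 3) • (h1 * x 1)
      + (a ^ 3 * b * ω - b * c ^ 3 * ω ^ 2 - b * c ^ 3 * ω) • (h1 * x 2)
      + (-a ^ 2 * c ^ 2 * ω ^ 2) • (h2 * x 0) + (a ^ 2 * b ^ 2) • (h2 * x 1)
      + (-a * b ^ 3 + a * c ^ 3) • (x 0 * h0) + (-b ^ 2 * c ^ 2) • (x 0 * h1)
      + (b ^ 2 * c ^ 2 * ω ^ 2 + b ^ 2 * c ^ 2 * ω) • (x 0 * h2)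
      + (a ^ 2 * b * c * ω ^ 2) • (x 1 * h0) + (-a * c ^ 3) • (x 1 * h2)
      + (-a ^ 2 * b * c) • (x 2 * h0) + (a * c ^ 3 * ω ^ 2) • (x 2 * h1)
      + (a ^ 2 * b ^ 3 * ω - a ^ 2 * b ^ 3 - a ^ 2 * c ^ 3 * ω
        + a ^ 2 * c ^ 3) • hN (x 1 * x 0 * x 1)
      + (a ^ 4 * b - a * b * c ^ 3) • hN (x 1 * x 0 * x 2)
      + (-a ^ 3 * b * c + b * c ^ 4) • hN (x 1 * x 1 * x 2)
      + (a ^ 2 * b ^ 3 * ω - a ^ 2 * b ^ 3 - a ^ 2 * c ^ 3 * ω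
        + a ^ 2 * c ^ 3) • hN (x 2 * x 0 * x 1)
    simp only [cubic, mul_add, add_mul, mul_sub, sub_mul, smul_mul_assoc, mul_smul_comm, mul_assoc,
      mul_zero, zero_mul]
    module

end CubicIdentities

end IsSklyanin

namespace IsSklyanin

section UpperBound

variable {k : Type u} [Field k] {a b c : k} {S : Type u} [Ring S] [Algebra k S] {x : Fin 3 → S}

lemma exists_proj_mul (h : IsSklyanin a b c x) {m : ℕ} {s : S} (hs : s ∈ V k x ^ m) (t : S)
    (n : ℕ) : ∃ t' ∈ V k x ^ (n - m), (n < m → t' = 0) ∧ h.proj n (s * t) = s * t' := by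
  rcases lt_or_ge n m with hnm | hnm
  · refine ⟨0, zero_mem _, fun _ => rfl, ?_⟩
    change (h.gradingHom (s * t)).coeff n = s * 0
    rw [map_mul, h.gradingHom_of_mem hs, ← Polynomial.C_mul_X_pow_eq_monomial, mul_assoc,
      Polynomial.coeff_C_mul, Polynomial.coeff_X_pow_mul', if_neg (not_le.2 hnm)]
  · refine ⟨h.proj (n - m) t, h.proj_mem _ t, fun hlt => absurd hnm (not_le.2 hlt), ?_⟩
    rw [← h.proj_mul_left (n - m) t hs, Nat.sub_add_cancel hnm]

/-- Successors of a point in a quotient of `S` by a right ideal. -/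
lemma exists_succ_point (h : IsSklyanin a b c x) (ha : a ≠ 0) (hb : b ≠ 0)
    (habc : ¬(a ^ 3 = b ^ 3 ∧ b ^ 3 = c ^ 3)) {Q : Submodule k S}
    (hQ : ∀ s ∈ Q, ∀ i, s * x i ∈ Q) {e : S} {p : Fin 3 → k}
    (hep : ∀ i j, p i • (e * x j) - p j • (e * x i) ∈ Q) {l : Fin 3} (hl : p l ≠ 0) :
    ∃ p' : Fin 3 → k, p' ≠ 0 ∧
      ∀ i j, p' i • (e * x l * x j) - p' j • (e * x l * x i) ∈ Q := by
  have hp : p ≠ 0 := fun h0 => hl (congrFun h0 l)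
  obtain ⟨j, m, hjm⟩ := exists_relAdj_ne_zero ha hb habc hp
  refine ⟨fun i => relAdj a b c p i m, fun h0 => hjm (congrFun h0 j), fun i j => ?_⟩
  have hrel : ∀ i, relForm a b c p (fun j => Q.mkQ (e * x l * x j)) i = 0 := by
    intro i
    simp only [relForm, ← map_smul, ← map_add]
    rw [Submodule.mkQ_apply, Submodule.Quotient.mk_eq_zero]
    have h0 := congrArg (fun s => p l • (e * s)) (h.rel i)
    simp only [mul_zero, smul_zero, mul_add, mul_smul_comm, ← mul_assoc] at h0
    have hq : ∀ i j, p i • (e * x l * x j) - p l • (e * x i * x j) ∈ Q := by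
      intro i j
      have := hQ _ (hep i l) j
      rwa [sub_mul, smul_mul_assoc, smul_mul_assoc] at this
    have := Q.add_mem (Q.add_mem (Q.smul_mem a (hq (i + 1) (i + 2)))
      (Q.smul_mem b (hq (i + 2) (i + 1)))) (Q.smul_mem c (hq i i))
    convert this using 1
    linear_combination (norm := module) h0
  have := relAdj_smul hrel i j m
  rw [← Submodule.Quotient.mk_eq_zero, ← Submodule.mkQ_apply, map_sub, map_smul, map_smul, this,
    sub_self]

/-- A cyclic module generated in degree zero which looks like a point module in degree one is
at most one-dimensional in every degree. -/
lemma exists_mul_mem_sup_span (h : IsSklyanin a b c x) (ha : a ≠ 0) (hb : b ≠ 0)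
    (habc : ¬(a ^ 3 = b ^ 3 ∧ b ^ 3 = c ^ 3)) {Q : Submodule k S}
    (hQ : ∀ s ∈ Q, ∀ i, s * x i ∈ Q) {e : S} {p : Fin 3 → k} (hp : p ≠ 0)
    (hep : ∀ i j, p i • (e * x j) - p j • (e * x i) ∈ Q) (n : ℕ) :
    ∃ w, ∀ t ∈ V k x ^ n, ∃ r : k, e * t - r • w ∈ Q := by
  suffices ∃ w, ∃ p' : Fin 3 → k, p' ≠ 0 ∧ (∀ i j, p' i • (w * x j) - p' j • (w * x i) ∈ Q) ∧
      ∀ t ∈ V k x ^ n, ∃ r : k, e * t - r • w ∈ Q by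
    obtain ⟨w, _, _, _, hw⟩ := this
    exact ⟨w, hw⟩
  induction n with
  | zero =>
    refine ⟨e, p, hp, hep, fun t ht => ?_⟩
    rw [pow_zero, Submodule.mem_one] at ht
    obtain ⟨r, rfl⟩ := ht
    refine ⟨r, ?_⟩
    rw [← Algebra.commutes, ← Algebra.smul_def, sub_self]
    exact Q.zero_mem
  | succ n ih =>
    obtain ⟨w, p', hp', hwp, hw⟩ := ih
    obtain ⟨l, hl⟩ := Function.ne_iff.1 hp'
    obtain ⟨q, hq, hwq⟩ := h.exists_succ_point ha hb habc hQ hwp hl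
    refine ⟨w * x l, q, hq, hwq, fun t ht => ?_⟩
    obtain ⟨s, hs, rfl⟩ := mem_pow_succ_iff.1 ht
    choose r hr using fun i => hw (s i) (hs i)
    refine ⟨∑ i, r i * (p' i / p' l), ?_⟩
    rw [Finset.mul_sum, Finset.sum_smul, ← Finset.sum_sub_distrib]
    refine Q.sum_mem fun i _ => ?_
    have h1 := hQ _ (hr i) i
    have h2 := Q.smul_mem (-(r i / p' l)) (hwp i l)
    have h3 := Q.add_mem h1 h2
    convert h3 using 1
    rw [sub_mul, smul_mul_assoc, smul_sub, smul_smul, smul_smul, ← mul_assoc]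
    have h4 : -(r i / p' l) * p' l = -r i := by
      rw [neg_mul, div_mul_cancel₀ _ hl]
    rw [h4]
    module

/-- The sum of the principal right ideals generated by two elements. -/
def rightIdeal (k : Type u) [Field k] {S : Type u} [Ring S] [Algebra k S] (u v : S) :
    Submodule k S :=
  LinearMap.range (LinearMap.mulLeft k u) ⊔ LinearMap.range (LinearMap.mulLeft k v)

lemma mem_rightIdeal {u v s : S} : s ∈ rightIdeal k u v ↔ ∃ t t', u * t + v * t' = s := by
  simp [rightIdeal, Submodule.mem_sup]

lemma rightIdeal_mul_gen {u v s : S} (hs : s ∈ rightIdeal k u v) (i : Fin 3) :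
    s * x i ∈ rightIdeal k u v := by
  obtain ⟨t, t', rfl⟩ := mem_rightIdeal.1 hs
  exact mem_rightIdeal.2 ⟨t * x i, t' * x i, by rw [add_mul, mul_assoc, mul_assoc]⟩

lemma forall_minor_mem {Q : Submodule k S} {p : Fin 3 → k} {n : Fin 3 → S}
    (h01 : p 0 • n 1 - p 1 • n 0 ∈ Q) (h02 : p 0 • n 2 - p 2 • n 0 ∈ Q)
    (h12 : p 1 • n 2 - p 2 • n 1 ∈ Q) (i j : Fin 3) : p i • n j - p j • n i ∈ Q := by
  have h10 := Q.neg_mem h01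
  have h20 := Q.neg_mem h02
  have h21 := Q.neg_mem h12
  rw [neg_sub] at h10 h20 h21
  fin_cases i <;> fin_cases j <;> simp only [Fin.zero_eta, Fin.mk_one, Fin.reduceFinMk, sub_self,
    zero_mem] <;> assumption

lemma exists_homogeneous_step (h : IsSklyanin a b c x) (ha : a ≠ 0) (hb : b ≠ 0)
    (habc : ¬(a ^ 3 = b ^ 3 ∧ b ^ 3 = c ^ 3)) {e u : S} {m m' : ℕ} (he : e ∈ V k x ^ m)
    (hu : u ∈ V k x ^ m') {p : Fin 3 → k} (hp : p ≠ 0)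
    (hep : ∀ i j, p i • (e * x j) - p j • (e * x i) ∈ rightIdeal k (x 0) u) (n : ℕ) :
    ∃ w, ∀ t ∈ V k x ^ (n - m), (n < m → t = 0) → ∃ s ∈ V k x ^ (n - 1),
      ∃ t' ∈ V k x ^ (n - m'), (n < m' → t' = 0) ∧ (n < 1 → s = 0) ∧
        ∃ r : k, e * t = x 0 * s + u * t' + r • w := by
  obtain ⟨w, hw⟩ := h.exists_mul_mem_sup_span ha hb habc (fun s hs i => rightIdeal_mul_gen hs i)
    hp hep (n - m)
  refine ⟨h.proj n w, fun t ht h0 => ?_⟩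
  obtain ⟨r, hr⟩ := hw t ht
  obtain ⟨s₀, t₀, hst⟩ := mem_rightIdeal.1 hr
  have hx : x 0 ∈ V k x ^ 1 := by
    rw [pow_one]
    exact gen_mem 0
  obtain ⟨s, hs, hs0, hs'⟩ := h.exists_proj_mul hx s₀ n
  obtain ⟨t', ht', ht0, ht''⟩ := h.exists_proj_mul hu t₀ n
  refine ⟨s, hs, t', ht', ht0, hs0, r, ?_⟩
  have hproj : h.proj n (e * t) = e * t := by
    rcases lt_or_ge n m with hnm | hnm
    · rw [h0 hnm, mul_zero, map_zero]
    · apply h.proj_of_mem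
      have := mul_mem_pow he ht
      rwa [Nat.add_sub_cancel' hnm] at this
  have := congrArg (h.proj n) hst
  rw [map_add, map_sub, map_smul, hs', ht'', hproj] at this
  rw [this, sub_add_cancel]

/-- The multiples of the cubic central element in degree `n`. -/
def multiples (a b c : k) (x : Fin 3 → S) : ℕ → Submodule k S
  | n + 3 => (V k x ^ n).map (LinearMap.mulLeft k (cubic a b c x))
  | _ => ⊥

lemma mul_mem_multiples {n : ℕ} {t : S} (ht : t ∈ V k x ^ (n - 3)) (h0 : n < 3 → t = 0) :
    cubic a b c x * t ∈ multiples a b c x n := by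
  match n with
  | 0 | 1 | 2 => simp [h0, multiples]
  | n + 3 => exact ⟨t, ht, rfl⟩

lemma multiples_le (n : ℕ) : multiples a b c x n ≤ V k x ^ n := by
  match n with
  | 0 | 1 | 2 => exact bot_le
  | n + 3 =>
    rintro _ ⟨t, ht, rfl⟩
    have := mul_mem_pow (cubic_mem (a := a) (b := b) (c := c)) ht
    rwa [add_comm] at this

lemma gen_mul_mem_multiples (h : IsSklyanin a b c x) {n : ℕ} {s : S} (i : Fin 3)
    (hs : s ∈ multiples a b c x n) : x i * s ∈ multiples a b c x (n + 1) := by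
  match n with
  | 0 | 1 | 2 =>
    have : s = 0 := hs
    rw [this, mul_zero]
    exact zero_mem _
  | n + 3 =>
    obtain ⟨t, ht, rfl⟩ := hs
    refine ⟨x i * t, gen_mul_mem i ht, ?_⟩
    rw [LinearMap.mulLeft_apply, LinearMap.mulLeft_apply, ← mul_assoc, ← mul_assoc,
      h.cubic_mul_gen]

lemma mul_vanishing_form_mem (h : IsSklyanin a b c x) (ha : a ≠ 0) (hc : c ≠ 0) {ω : k}
    (hω : 1 + ω + ω ^ 2 = 0) (i j : Fin 3) :
    (![c, a * ω, b * ω ^ 2] : Fin 3 → k) i • ((x 1 + x 2) * x j)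
      - (![c, a * ω, b * ω ^ 2] : Fin 3 → k) j • ((x 1 + x 2) * x i) ∈
    rightIdeal k (x 0) ((x 1 + x 2) * ((a * ω) • x 0 - c • x 1)) := by
  have h0 := h.rel 0
  have h1 := h.rel 1
  have h2 := h.rel 2
  simp only [Fin.isValue, Fin.reduceAdd] at h0 h1 h2
  have hN : ∀ s : S, (1 + ω + ω ^ 2) • s = 0 := fun s => by rw [hω, zero_smul]
  revert i j
  refine forall_minor_mem (n := fun j => (x 1 + x 2) * x j) ?_ ?_ ?_
  · refine mem_rightIdeal.2 ⟨0, -1, ?_⟩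
    simp only [Matrix.cons_val_zero, Matrix.cons_val_one, mul_sub, mul_smul_comm]
    simp
  · rw [← Submodule.smul_mem_iff _ ha]
    refine mem_rightIdeal.2 ⟨-((a ^ 2) • x 1 + (b ^ 2) • x 2 + (c ^ 2) • x 0), algebraMap k S b, ?_⟩
    rw [← Algebra.commutes, ← Algebra.smul_def]
    simp only [Matrix.cons_val_zero, Matrix.cons_val]
    linear_combination (norm := skip) (-a) • h2 - b • h1 - c • h0
      + (a * b) • hN (x 1 * x 0) + (a * b) • hN (x 2 * x 0)
    simp only [mul_add, add_mul, mul_sub, mul_smul_comm, mul_neg]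
    module
  · rw [← Submodule.smul_mem_iff _ hc]
    refine mem_rightIdeal.2 ⟨-(ω • ((a ^ 2) • x 1 + (b ^ 2) • x 2 + (c ^ 2) • x 0)),
      algebraMap k S (-b), ?_⟩
    rw [← Algebra.commutes, ← Algebra.smul_def]
    simp only [Matrix.cons_val_one, Matrix.cons_val]
    linear_combination (norm := skip) (-(a * ω)) • h2 - (b * ω) • h1 - (c * ω) • h0
      + (b * c) • hN (x 1 * x 1) + (b * c) • hN (x 2 * x 1)
    simp only [mul_add, add_mul, mul_sub, mul_smul_comm, mul_neg]
    module

lemma mul_vanishing_forms_mem (h : IsSklyanin a b c x) (hb : b ≠ 0) {ω : k}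
    (hω : 1 + ω + ω ^ 2 = 0) (i j : Fin 3) :
    (![c * ω * (b ^ 3 - a ^ 3), b * (a ^ 3 - c ^ 3), a * ω ^ 2 * (c ^ 3 - b ^ 3)] : Fin 3 → k) i •
        ((x 1 + x 2) * ((a * ω) • x 0 - c • x 1) * x j)
      - (![c * ω * (b ^ 3 - a ^ 3), b * (a ^ 3 - c ^ 3), a * ω ^ 2 * (c ^ 3 - b ^ 3)] :
          Fin 3 → k) j • ((x 1 + x 2) * ((a * ω) • x 0 - c • x 1) * x i) ∈
    rightIdeal k (x 0) (cubic a b c x) := by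
  have hmem : ∀ y : S, (∃ s : S, ∃ r : k, y = x 0 * s + r • cubic a b c x) →
      y ∈ rightIdeal k (x 0) (cubic a b c x) := by
    rintro _ ⟨s, r, rfl⟩
    exact mem_rightIdeal.2 ⟨s, algebraMap k S r, by rw [← Algebra.commutes, ← Algebra.smul_def]⟩
  obtain ⟨h01, h02, h12⟩ := h.cubic_point_identities hω
  revert i j
  refine forall_minor_mem (n := fun j => (x 1 + x 2) * ((a * ω) • x 0 - c • x 1) * x j)
    (hmem _ h01) ?_ (hmem _ h12)
  rw [← Submodule.smul_mem_iff _ hb, smul_sub, smul_smul, smul_smul]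
  exact hmem _ h02

lemma pow_succ_le (h : IsSklyanin a b c x) [IsAlgClosed k] [CharZero k] (ha : a ≠ 0) (hb : b ≠ 0)
    (hc : c ≠ 0) (habc : ¬(a ^ 3 = b ^ 3 ∧ b ^ 3 = c ^ 3)) (n : ℕ) :
    ∃ w : Fin 3 → S, V k x ^ (n + 1) ≤ (V k x ^ n).map (LinearMap.mulLeft k (x 0)) ⊔
      multiples a b c x (n + 1) ⊔ Submodule.span k (Set.range w) := by
  obtain ⟨ω, hω⟩ := exists_sq_add_add_one_eq_zero k
  have hω0 : ω ≠ 0 := by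
    rintro rfl
    simp at hω
  let v : S := x 1 + x 2
  let v' : S := (a * ω) • x 0 - c • x 1
  have hv : v ∈ V k x ^ 1 := by
    rw [pow_one]
    exact add_mem (gen_mem 1) (gen_mem 2)
  have hv' : v' ∈ V k x ^ 1 := by
    rw [pow_one]
    exact sub_mem (Submodule.smul_mem _ _ (gen_mem 0)) (Submodule.smul_mem _ _ (gen_mem 1))
  have h1 : (1 : S) ∈ V k x ^ 0 := by
    rw [pow_zero]
    exact Submodule.one_le.1 le_rfl
  have hp₁ : (![0, 1, -1] : Fin 3 → k) ≠ 0 := fun h0 => by simpa using congrFun h0 1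
  have hp₂ : (![c, a * ω, b * ω ^ 2] : Fin 3 → k) ≠ 0 := fun h0 => hc (by simpa using congrFun h0 0)
  have hp₃ : (![c * ω * (b ^ 3 - a ^ 3), b * (a ^ 3 - c ^ 3), a * ω ^ 2 * (c ^ 3 - b ^ 3)] :
      Fin 3 → k) ≠ 0 := fun h0 => by
    have e0 := congrFun h0 0
    have e2 := congrFun h0 2
    simp only [Matrix.cons_val_zero, Matrix.cons_val, Pi.zero_apply, mul_eq_zero, ha, hc, hω0,
      pow_eq_zero_iff, ne_eq, OfNat.ofNat_ne_zero, not_false_eq_true, false_or, sub_eq_zero]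
      at e0 e2
    exact habc ⟨e0.symm, e2.symm⟩
  obtain ⟨w₁, hw₁⟩ := h.exists_homogeneous_step ha hb habc h1 hv hp₁ (by
    refine forall_minor_mem (n := fun j => 1 * x j) ?_ ?_ ?_
    · exact mem_rightIdeal.2 ⟨-1, 0, by simp⟩
    · exact mem_rightIdeal.2 ⟨1, 0, by simp⟩
    · exact mem_rightIdeal.2 ⟨0, 1, by simp [v, add_comm]⟩) (n + 1)
  obtain ⟨w₂, hw₂⟩ := h.exists_homogeneous_step ha hb habc hv (mul_mem_pow hv hv') hp₂
    (h.mul_vanishing_form_mem ha hc hω) (n + 1)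
  obtain ⟨w₃, hw₃⟩ := h.exists_homogeneous_step ha hb habc (mul_mem_pow hv hv') cubic_mem hp₃
    (h.mul_vanishing_forms_mem hb hω) (n + 1)
  refine ⟨![w₁, w₂, w₃], fun t ht => ?_⟩
  obtain ⟨s₁, hs₁, t₁, ht₁, hz₁, -, r₁, e₁⟩ := hw₁ t ht (fun h0 => absurd h0 (Nat.not_lt_zero _))
  obtain ⟨s₂, hs₂, t₂, ht₂, hz₂, -, r₂, e₂⟩ := hw₂ t₁ ht₁ hz₁
  obtain ⟨s₃, hs₃, t₃, ht₃, hz₃, -, r₃, e₃⟩ := hw₃ t₂ ht₂ hz₂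
  have e : t = x 0 * (s₁ + s₂ + s₃) + cubic a b c x * t₃ + (r₁ • w₁ + r₂ • w₂ + r₃ • w₃) := by
    rw [one_mul, e₂, e₃] at e₁
    rw [e₁, mul_add, mul_add]
    abel
  rw [e]
  refine add_mem (add_mem (Submodule.mem_sup_left (Submodule.mem_sup_left ?_))
    (Submodule.mem_sup_left (Submodule.mem_sup_right ?_))) (Submodule.mem_sup_right ?_)
  · exact ⟨s₁ + s₂ + s₃, add_mem (add_mem hs₁ hs₂) hs₃, rfl⟩
  · exact mul_mem_multiples ht₃ hz₃
  · rw [Submodule.mem_span_range_iff_exists_fun]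
    exact ⟨![r₁, r₂, r₃], by simp [Fin.sum_univ_three]⟩

/-- The forms of degree `n`, modulo the multiples of the cubic central element, have dimension
at most `3 n`. -/
lemma exists_pow_le_sup_multiples (h : IsSklyanin a b c x) [IsAlgClosed k] [CharZero k]
    (ha : a ≠ 0) (hb : b ≠ 0) (hc : c ≠ 0) (habc : ¬(a ^ 3 = b ^ 3 ∧ b ^ 3 = c ^ 3)) (n : ℕ) :
    ∃ U : Submodule k S, Module.Finite k U ∧ Module.finrank k U ≤ 3 * (n + 1) ∧
      V k x ^ (n + 1) ≤ U ⊔ multiples a b c x (n + 1) := by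
  have hspan : ∀ w : Fin 3 → S, Module.Finite k (Submodule.span k (Set.range w)) ∧
      Module.finrank k (Submodule.span k (Set.range w)) ≤ 3 := fun w =>
    ⟨FiniteDimensional.span_of_finite k (Set.finite_range w),
      (finrank_range_le_card w).trans_eq (Fintype.card_fin 3)⟩
  induction n with
  | zero =>
    refine ⟨V k x, (hspan x).1, (hspan x).2, ?_⟩
    rw [zero_add, pow_one]
    exact le_sup_left
  | succ n ih =>
    obtain ⟨U, _, hU, hle⟩ := ih
    obtain ⟨w, hw⟩ := h.pow_succ_le ha hb hc habc (n + 1)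
    obtain ⟨_, hW⟩ := hspan w
    refine ⟨U.map (LinearMap.mulLeft k (x 0)) ⊔ Submodule.span k (Set.range w), inferInstance,
      ?_, ?_⟩
    · have h1 := Submodule.finrank_add_le_finrank_add_finrank (U.map (LinearMap.mulLeft k (x 0)))
        (Submodule.span k (Set.range w))
      have h2 := Submodule.finrank_map_le (LinearMap.mulLeft k (x 0)) U
      omega
    · have hx : (multiples a b c x (n + 1)).map (LinearMap.mulLeft k (x 0)) ≤
          multiples a b c x (n + 2) := by
        rintro _ ⟨s, hs, rfl⟩
        exact h.gen_mul_mem_multiples 0 hs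
      have h1 : (V k x ^ (n + 1)).map (LinearMap.mulLeft k (x 0)) ≤
          U.map (LinearMap.mulLeft k (x 0)) ⊔ multiples a b c x (n + 2) :=
        (Submodule.map_mono hle).trans (by rw [Submodule.map_sup]; exact sup_le_sup_left hx _)
      refine hw.trans (sup_le (sup_le (h1.trans ?_) le_sup_right) ?_)
      · exact sup_le_sup_right le_sup_left _
      · exact le_sup_right.trans le_sup_left

end UpperBound

end IsSklyanin

namespace IsSklyanin

section HilbertSeries

variable {k : Type u} [Field k] {a b c : k} {S : Type u} [Ring S] [Algebra k S] {x : Fin 3 → S}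

lemma ev_of_mem_multiples (h : IsSklyanin a b c x) (ha : a ≠ 0) (hb : b ≠ 0)
    (habc : ¬(a ^ 3 = b ^ 3 ∧ b ^ 3 = c ^ 3)) {n : ℕ} {s : S} (hs : s ∈ multiples a b c x n)
    (P : PointChain a b c) (j : ℤ) : h.ev P j s = 0 := by
  match n with
  | 0 | 1 | 2 =>
    have : s = 0 := hs
    rw [this, map_zero]
  | n + 3 =>
    obtain ⟨t, -, rfl⟩ := hs
    rw [LinearMap.mulLeft_apply, h.ev_mul P cubic_mem, h.ev_cubic P ha hb habc, zero_mul]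

instance multiples_finite (n : ℕ) : Module.Finite k (multiples a b c x n) :=
  Submodule.finiteDimensional_of_le (multiples_le n)

lemma finrank_pow_le (h : IsSklyanin a b c x) [IsAlgClosed k] [CharZero k] (ha : a ≠ 0)
    (hb : b ≠ 0) (hc : c ≠ 0) (habc : ¬(a ^ 3 = b ^ 3 ∧ b ^ 3 = c ^ 3)) (n : ℕ) :
    Module.finrank k ↥(V k x ^ (n + 1)) ≤
      3 * (n + 1) + Module.finrank k (multiples a b c x (n + 1)) := by
  obtain ⟨U, _, hU, hle⟩ := h.exists_pow_le_sup_multiples ha hb hc habc n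
  have h1 := Submodule.finrank_mono hle
  have h2 := Submodule.finrank_add_le_finrank_add_finrank U (multiples a b c x (n + 1))
  omega

/-- Evaluation of the forms of degree `n` at a finite family of truncated point modules. -/
def evMap (h : IsSklyanin a b c x) (n : ℕ) {ι : Type} (T : ι → PointChain a b c × ℤ) :
    ↥(V k x ^ n) →ₗ[k] ι → k :=
  (LinearMap.pi fun i => h.ev (T i).1 (T i).2).domRestrict _

lemma exists_finrank_ker_evMap (h : IsSklyanin a b c x) [IsAlgClosed k] [CharZero k] (ha : a ≠ 0)
    (hb : b ≠ 0) (hc : c ≠ 0) (habc : ¬(a ^ 3 = b ^ 3 ∧ b ^ 3 = c ^ 3)) (n : ℕ) :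
    ∃ (ι : Type) (T : ι → PointChain a b c × ℤ),
      3 * (n + 1) + Module.finrank k (LinearMap.ker (h.evMap (n + 1) T)) =
        Module.finrank k ↥(V k x ^ (n + 1)) := by
  obtain ⟨ι, _, T, hcard, hT⟩ := h.exists_separating ha hb hc habc n
  refine ⟨ι, T, ?_⟩
  have hsurj : LinearMap.range (h.evMap (n + 1) T) = ⊤ := by
    rw [LinearMap.range_eq_top]
    intro w
    obtain ⟨s, hs, hw⟩ := hT w
    exact ⟨⟨s, hs⟩, funext hw⟩
  have := LinearMap.finrank_range_add_finrank_ker (h.evMap (n + 1) T)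
  rwa [hsurj, finrank_top, Module.finrank_fintype_fun_eq_card, hcard] at this

/-- A form of positive degree vanishing on all point modules is a multiple of the cubic
central element. -/
lemma mem_multiples_of_ev_eq_zero (h : IsSklyanin a b c x) [IsAlgClosed k] [CharZero k]
    (ha : a ≠ 0) (hb : b ≠ 0) (hc : c ≠ 0) (habc : ¬(a ^ 3 = b ^ 3 ∧ b ^ 3 = c ^ 3)) {n : ℕ} {s : S}
    (hs : s ∈ V k x ^ (n + 1)) (h0 : ∀ P j, h.ev P j s = 0) : s ∈ multiples a b c x (n + 1) := by
  obtain ⟨ι, T, hT⟩ := h.exists_finrank_ker_evMap ha hb hc habc n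
  have hle : (multiples a b c x (n + 1)).comap (V k x ^ (n + 1)).subtype ≤
      LinearMap.ker (h.evMap (n + 1) T) := by
    intro t ht
    exact funext fun i => h.ev_of_mem_multiples ha hb habc ht _ _
  have hfin : Module.finrank k ((multiples a b c x (n + 1)).comap (V k x ^ (n + 1)).subtype) =
      Module.finrank k (multiples a b c x (n + 1)) :=
    (Submodule.comapSubtypeEquivOfLe (multiples_le (n + 1))).finrank_eq
  have heq := Submodule.eq_of_le_of_finrank_le hle (by
    have := h.finrank_pow_le ha hb hc habc n
    omega)
  have hker : (⟨s, hs⟩ : ↥(V k x ^ (n + 1))) ∈ LinearMap.ker (h.evMap (n + 1) T) :=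
    funext fun i => h0 _ _
  rw [← heq] at hker
  exact hker

lemma exists_pointChain (h : IsSklyanin a b c x) [IsAlgClosed k] [CharZero k] (ha : a ≠ 0)
    (hb : b ≠ 0) (hc : c ≠ 0) (habc : ¬(a ^ 3 = b ^ 3 ∧ b ^ 3 = c ^ 3)) :
    Nonempty (PointChain a b c) := by
  obtain ⟨ι, _, T, hcard, -⟩ := h.exists_separating ha hb hc habc 0
  have : Nonempty ι := Fintype.card_pos_iff.1 (by omega)
  exact ⟨(T this.some).1⟩

lemma ev_eq_zero_of_mul_gen_eq_zero (h : IsSklyanin a b c x) {n : ℕ} {s : S}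
    (hs : s ∈ V k x ^ n) (h0 : ∀ i, s * x i = 0) (P : PointChain a b c) (j : ℤ) :
    h.ev P j s = 0 := by
  obtain ⟨i, hi⟩ := P.exists_coord_ne_zero (j + n)
  have := congrArg (h.ev P j) (h0 i)
  rw [h.ev_mul P hs, ev_gen, map_zero] at this
  exact (mul_eq_zero.1 this).resolve_right hi

/-- The socle of `S` vanishes in degree `n` as soon as the cubic central element is regular in
smaller degrees. -/
lemma eq_zero_of_mul_gen_eq_zero (h : IsSklyanin a b c x) [IsAlgClosed k] [CharZero k]
    (ha : a ≠ 0) (hb : b ≠ 0) (hc : c ≠ 0) (habc : ¬(a ^ 3 = b ^ 3 ∧ b ^ 3 = c ^ 3)) {n : ℕ}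
    (hinj : ∀ m < n, ∀ s ∈ V k x ^ m, cubic a b c x * s = 0 → s = 0) {s : S}
    (hs : s ∈ V k x ^ n) (h0 : ∀ i, s * x i = 0) : s = 0 := by
  induction n using Nat.strong_induction_on generalizing s with
  | _ n ih =>
  have hev := h.ev_eq_zero_of_mul_gen_eq_zero hs h0
  match n with
  | 0 =>
    obtain ⟨P⟩ := h.exists_pointChain ha hb hc habc
    rw [pow_zero, Submodule.mem_one] at hs
    obtain ⟨r, rfl⟩ := hs
    have := hev P 0
    rw [Algebra.algebraMap_eq_smul_one, map_smul, ev_one, smul_eq_mul, mul_one] at this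
    rw [this, map_zero]
  | 1 | 2 => exact h.mem_multiples_of_ev_eq_zero ha hb hc habc hs hev
  | n + 3 =>
    obtain ⟨t, ht, rfl⟩ := h.mem_multiples_of_ev_eq_zero ha hb hc habc hs hev
    have ht0 : t = 0 := by
      refine ih n (by omega) (fun m hm => hinj m (by omega)) ht fun i => ?_
      refine hinj (n + 1) (by omega) _ (mul_gen_mem i ht) ?_
      rw [← mul_assoc]
      exact h0 i
    rw [ht0, map_zero]

/-- The last differential of the Koszul complex, in degree `n`. -/
def mulGens (k : Type u) [Field k] {S : Type u} [Ring S] [Algebra k S] (x : Fin 3 → S) (n : ℕ) :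
    (Fin 3 → ↥(V k x ^ n)) →ₗ[k] S where
  toFun t := ∑ i, (t i : S) * x i
  map_add' t t' := by simp [add_mul, Finset.sum_add_distrib]
  map_smul' r t := by simp [Finset.smul_sum]

lemma range_mulGens (n : ℕ) : LinearMap.range (mulGens k x n) = V k x ^ (n + 1) := by
  ext s
  rw [LinearMap.mem_range, mem_pow_succ_iff]
  constructor
  · rintro ⟨t, rfl⟩
    exact ⟨fun i => t i, fun i => (t i).2, rfl⟩
  · rintro ⟨t, ht, rfl⟩
    exact ⟨fun i => ⟨t i, ht i⟩, rfl⟩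

lemma kosz_mem {n : ℕ} {t : Fin 3 → S} (ht : ∀ i, t i ∈ V k x ^ n) (j : Fin 3) :
    kosz a b c x t j ∈ V k x ^ (n + 1) :=
  add_mem (add_mem (Submodule.smul_mem _ _ (mul_gen_mem _ (ht _)))
    (Submodule.smul_mem _ _ (mul_gen_mem _ (ht _)))) (Submodule.smul_mem _ _ (mul_gen_mem _ (ht _)))

/-- The second differential of the Koszul complex, in degree `n`. -/
def koszPow (a b c : k) (x : Fin 3 → S) (n : ℕ) :
    (Fin 3 → ↥(V k x ^ n)) →ₗ[k] (Fin 3 → ↥(V k x ^ (n + 1))) where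
  toFun t j := ⟨kosz a b c x (fun i => t i) j, kosz_mem (fun i => (t i).2) j⟩
  map_add' t t' := by
    ext j
    exact congrFun ((kosz a b c x).map_add (fun i => (t i : S)) (fun i => (t' i : S))) j
  map_smul' r t := by
    ext j
    exact congrFun ((kosz a b c x).map_smul_of_tower r (fun i => (t i : S))) j

/-- The first differential of the Koszul complex, in degree `n`. -/
def genMul (k : Type u) [Field k] {S : Type u} [Ring S] [Algebra k S] (x : Fin 3 → S) (n : ℕ) :
    ↥(V k x ^ n) →ₗ[k] (Fin 3 → ↥(V k x ^ (n + 1))) where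
  toFun s i := ⟨s * x i, mul_gen_mem i s.2⟩
  map_add' s t := by
    ext i
    simp [add_mul]
  map_smul' r s := by
    ext i
    simp

lemma ker_mulGens_le (h : IsSklyanin a b c x) (n : ℕ) :
    LinearMap.ker (mulGens k x (n + 1)) ≤ LinearMap.range (koszPow a b c x n) := by
  intro s hs
  obtain ⟨t, ht⟩ := h.exists_kosz_eq (s := fun i => (s i : S)) hs
  refine ⟨fun i => ⟨h.proj n (t i), h.proj_mem n (t i)⟩, ?_⟩
  ext j
  have hj := congrArg (h.proj (n + 1)) (congrFun ht j)
  have hx : ∀ i, x i ∈ V k x ^ 1 := fun i => by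
    rw [pow_one]
    exact gen_mem i
  change kosz a b c x (fun i => h.proj n (t i)) j = s j
  simpa only [kosz_apply, map_add, map_smul, h.proj_mul_right n _ (hx _),
    h.proj_of_mem (s j).2] using hj

lemma range_genMul_le (h : IsSklyanin a b c x) (n : ℕ) :
    LinearMap.range (genMul k x n) ≤ LinearMap.ker (koszPow a b c x (n + 1)) := by
  rintro _ ⟨s, rfl⟩
  ext j
  exact congrFun (h.kosz_gen (s : S)) j

lemma finrank_koszul_le (h : IsSklyanin a b c x) {n : ℕ}
    (hsoc : ∀ s ∈ V k x ^ n, (∀ i, s * x i = 0) → s = 0) :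
    3 * Module.finrank k ↥(V k x ^ (n + 2)) + Module.finrank k ↥(V k x ^ n) ≤
      Module.finrank k ↥(V k x ^ (n + 3)) + 3 * Module.finrank k ↥(V k x ^ (n + 1)) := by
  have h1 := LinearMap.finrank_range_add_finrank_ker (mulGens k x (n + 2))
  have h2 := LinearMap.finrank_range_add_finrank_ker (koszPow a b c x (n + 1))
  have h3 := LinearMap.finrank_range_add_finrank_ker (genMul k x n)
  have h4 : LinearMap.ker (genMul k x n) = ⊥ := by
    rw [LinearMap.ker_eq_bot']
    intro s hs
    exact Subtype.ext (hsoc s s.2 fun i => congrArg Subtype.val (congrFun hs i))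
  have h5 := Submodule.finrank_mono (h.ker_mulGens_le (n + 1))
  have h6 := Submodule.finrank_mono (h.range_genMul_le n)
  change Module.finrank k (LinearMap.ker (mulGens k x (n + 2))) ≤ _ at h5
  rw [range_mulGens, Module.finrank_pi_fintype, Finset.sum_const, Finset.card_univ,
    Fintype.card_fin, smul_eq_mul] at h1
  change Module.finrank k ↥(V k x ^ (n + 3)) + _ = _ at h1
  rw [Module.finrank_pi_fintype, Finset.sum_const, Finset.card_univ, Fintype.card_fin,
    smul_eq_mul] at h2
  rw [h4, finrank_bot] at h3
  omega

lemma finrank_multiples_add (n : ℕ) :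
    Module.finrank k (multiples a b c x (n + 3)) + Module.finrank k (LinearMap.ker
      ((LinearMap.mulLeft k (cubic a b c x)).domRestrict (V k x ^ n))) =
      Module.finrank k ↥(V k x ^ n) := by
  rw [← LinearMap.finrank_range_add_finrank_ker
    ((LinearMap.mulLeft k (cubic a b c x)).domRestrict (V k x ^ n)), LinearMap.range_domRestrict]
  rfl

lemma finrank_pow_of_multiples_eq_bot (h : IsSklyanin a b c x) [IsAlgClosed k] [CharZero k]
    (ha : a ≠ 0) (hb : b ≠ 0) (hc : c ≠ 0) (habc : ¬(a ^ 3 = b ^ 3 ∧ b ^ 3 = c ^ 3)) {n : ℕ}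
    (hn : multiples a b c x (n + 1) = ⊥) :
    Module.finrank k ↥(V k x ^ (n + 1)) = 3 * (n + 1) := by
  obtain ⟨ι, T, hT⟩ := h.exists_finrank_ker_evMap ha hb hc habc n
  have := h.finrank_pow_le ha hb hc habc n
  rw [hn, finrank_bot] at this
  omega

/-- The Hilbert series of `S(a,b,c)` is that of a polynomial ring in three variables, and the
cubic central element is regular on forms. -/
lemma regular_and_finrank (h : IsSklyanin a b c x) [IsAlgClosed k] [CharZero k]
    (ha : a ≠ 0) (hb : b ≠ 0) (hc : c ≠ 0) (habc : ¬(a ^ 3 = b ^ 3 ∧ b ^ 3 = c ^ 3)) (n : ℕ) :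
    (∀ m < n, ∀ s ∈ V k x ^ m, cubic a b c x * s = 0 → s = 0) ∧
      2 * Module.finrank k ↥(V k x ^ n) = (n + 1) * (n + 2) ∧
      2 * Module.finrank k ↥(V k x ^ (n + 1)) = (n + 2) * (n + 3) ∧
      2 * Module.finrank k ↥(V k x ^ (n + 2)) = (n + 3) * (n + 4) := by
  induction n with
  | zero =>
    refine ⟨fun m hm => absurd hm (Nat.not_lt_zero _), ?_, ?_, ?_⟩
    · obtain ⟨P⟩ := h.exists_pointChain ha hb hc habc
      have : Nontrivial S := ⟨1, 0, fun h0 => by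
        have := h.ev_one P 0
        rw [h0, map_zero] at this
        exact zero_ne_one this⟩
      rw [pow_zero, Submodule.one_eq_span, finrank_span_singleton one_ne_zero]
    · rw [h.finrank_pow_of_multiples_eq_bot ha hb hc habc rfl]
    · rw [h.finrank_pow_of_multiples_eq_bot ha hb hc habc (n := 1) rfl]
  | succ n ih =>
    obtain ⟨hinj, hn, hn1, hn2⟩ := ih
    have hk := h.finrank_koszul_le fun s hs =>
      h.eq_zero_of_mul_gen_eq_zero ha hb hc habc hinj hs
    have hle := h.finrank_pow_le ha hb hc habc (n + 2)
    have hadd := finrank_multiples_add (a := a) (b := b) (c := c) (x := x) n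
    have hker : Module.finrank k (LinearMap.ker
        ((LinearMap.mulLeft k (cubic a b c x)).domRestrict (V k x ^ n))) = 0 := by
      nlinarith
    refine ⟨fun m hm s hs h0 => ?_, hn1, hn2, ?_⟩
    · rcases Nat.lt_succ_iff_lt_or_eq.1 hm with hm | rfl
      · exact hinj m hm s hs h0
      · rw [Submodule.finrank_eq_zero] at hker
        exact congrArg Subtype.val (LinearMap.ker_eq_bot'.1 hker ⟨s, hs⟩ h0)
    · change 2 * Module.finrank k ↥(V k x ^ (n + 3)) = (n + 4) * (n + 5)
      change _ ≤ 3 * (n + 3) + Module.finrank k (multiples a b c x (n + 3)) at hle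
      nlinarith

lemma eq_zero_of_cubic_mul_eq_zero (h : IsSklyanin a b c x) [IsAlgClosed k] [CharZero k]
    (ha : a ≠ 0) (hb : b ≠ 0) (hc : c ≠ 0) (habc : ¬(a ^ 3 = b ^ 3 ∧ b ^ 3 = c ^ 3)) {s : S}
    (hs : cubic a b c x * s = 0) : s = 0 := by
  refine h.eq_zero_of_proj fun n => ?_
  refine (h.regular_and_finrank ha hb hc habc (n + 1)).1 n n.lt_succ_self _ (h.proj_mem n s) ?_
  rw [← h.proj_mul_left n s cubic_mem, hs, map_zero]

end HilbertSeries

end IsSklyanin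

/-- The element `g = c(c³−b³)y³ + b(c³−a³)yxz + a(b³−c³)xyz + c(a³−c³)x³` of the
3-dimensional Sklyanin algebra `S(a,b,c)` is central and regular. -/
theorem sklyanin_g_central_and_regular
    (k : Type*) [Field k] [IsAlgClosed k] [CharZero k]
    (a b c : k) (habc : a * b * c ≠ 0)
    (hdeg : (3 * a * b * c) ^ 3 ≠ (a ^ 3 + b ^ 3 + c ^ 3) ^ 3) :
    (∀ s : Sklyanin k a b c, Sklyanin.g k a b c * s = s * Sklyanin.g k a b c) ∧
    (∀ s : Sklyanin k a b c, Sklyanin.g k a b c * s = 0 → s = 0) ∧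
    (∀ s : Sklyanin k a b c, s * Sklyanin.g k a b c = 0 → s = 0) := by
  have hc : c ≠ 0 := right_ne_zero_of_mul habc
  have hab : a * b ≠ 0 := left_ne_zero_of_mul habc
  have ha : a ≠ 0 := left_ne_zero_of_mul hab
  have hb : b ≠ 0 := right_ne_zero_of_mul hab
  have hcube : ¬(a ^ 3 = b ^ 3 ∧ b ^ 3 = c ^ 3) := by
    rintro ⟨h1, h2⟩
    apply hdeg
    rw [mul_pow, mul_pow, mul_pow, h1, h2]
    ring
  have h := Sklyanin.isSklyanin_gen k a b c
  have hg : Sklyanin.g k a b c = IsSklyanin.cubic a b c (Sklyanin.gen k a b c) := rfl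
  rw [hg]
  refine ⟨h.cubic_mul, fun s hs => h.eq_zero_of_cubic_mul_eq_zero ha hb hc hcube hs,
    fun s hs => h.eq_zero_of_cubic_mul_eq_zero ha hb hc hcube ?_⟩
  rw [h.cubic_mul, hs]

end
end
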